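/- arXiv:2311.02387 — 4 statements merged into one kernel-verified Lean document; each statement's English description precedes it below -/
import Mathlib

section
/- Let $p$ be an odd prime and $G$ the non-abelian group of order $p^3$ and exponent $p$. Every sequence over $G$ of length $p^3 + 3p - 3$ contains a subsequence of length $p^3$ whose product (in some order) lies in the center $Z(G)$. -/
theorem key_aux (p : ℕ) [Fact p.Prime] (hp3 : 3 ≤ p) {Q : Type*} [CommGroup Q] (x y : Q)
    (hx : x ^ p = 1) (hy : y ^ p = 1) (hgen : Subgroup.closure {x, y} = (⊤ : Subgroup Q))
    {ι : Type*} [Fintype ι] [DecidableEq ι] (f : ι → Q)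
    (hN : Fintype.card ι = p ^ 3 + 3 * p - 3) :
    ∃ S : Finset ι, S.card = p ^ 3 ∧ ∏ i ∈ S, f i = 1 := by
  classical
  let A := Q × Multiplicative (ZMod (p ^ 3))
  let R := MonoidAlgebra (ZMod p) A
  let o : A →* R := MonoidAlgebra.of (ZMod p) A
  haveI : CharP R p := charP_of_injective_algebraMap (R := ZMod p) (A := R)
    (FaithfulSMul.algebraMap_injective _ _) p
  let z : Multiplicative (ZMod (p ^ 3)) := Multiplicative.ofAdd 1
  let I1 : Ideal R := Ideal.span {o (x, 1) - 1}
  let I2 : Ideal R := Ideal.span {o (y, 1) - 1}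
  let I3 : Ideal R := Ideal.span {o (1, z) - 1}
  have h1 : I1 ^ p = ⊥ := by
    simp only [I1, Ideal.span_singleton_pow]
    rw [sub_pow_char, ← map_pow, Prod.pow_mk, hx, one_pow, one_pow]
    simp [← Prod.one_eq_mk]
  have h2 : I2 ^ p = ⊥ := by
    simp only [I2, Ideal.span_singleton_pow]
    rw [sub_pow_char, ← map_pow, Prod.pow_mk, hy, one_pow, one_pow]
    simp [← Prod.one_eq_mk]
  have hz : z ^ (p ^ 3) = 1 := by
    simp only [z, ← ofAdd_nsmul, nsmul_eq_mul, mul_one, ZMod.natCast_self, ofAdd_zero]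
  have h3 : I3 ^ (p ^ 3) = ⊥ := by
    simp only [I3, Ideal.span_singleton_pow]
    rw [sub_pow_char_pow, ← map_pow, Prod.pow_mk, hz, one_pow, one_pow]
    simp [← Prod.one_eq_mk]
  let I : Ideal R := (I1 ⊔ I2) ⊔ I3
  have hI : I ^ (p ^ 3 + 3 * p - 3) = ⊥ := by
    have ha : (I1 ⊔ I2) ^ (p + p) = ⊥ := by
      have := Ideal.sup_pow_add_le_pow_sup_pow (I := I1) (J := I2) (n := p) (m := p)
      rw [h1, h2] at this
      simpa using this
    have hb : I ^ ((p + p) + p ^ 3) = ⊥ := by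
      have := Ideal.sup_pow_add_le_pow_sup_pow (I := I1 ⊔ I2) (J := I3) (n := p + p) (m := p ^ 3)
      rw [ha, h3] at this
      simpa using this
    rw [eq_bot_iff, ← hb]
    exact Ideal.pow_le_pow_right (by omega)
  -- the subgroup of elements congruent to one
  let H : Subgroup A :=
    { carrier := {g | o g - 1 ∈ I}
      one_mem' := by simp
      mul_mem' := by
        intro a b ha hb
        have : o (a * b) - 1 = o a * (o b - 1) + (o a - 1) := by rw [map_mul]; ring
        simp only [Set.mem_ofPred_eq] at *
        rw [this]
        exact I.add_mem (I.mul_mem_left _ hb) ha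
      inv_mem' := by
        intro a ha
        have h : o a⁻¹ * o a = 1 := by rw [← map_mul, inv_mul_cancel, map_one]
        have : o a⁻¹ - 1 = - o a⁻¹ * (o a - 1) := by linear_combination h
        simp only [Set.mem_ofPred_eq] at *
        rw [this]
        exact I.mul_mem_left _ ha }
  have hH : ∀ g, o g - 1 ∈ I := by
    have hxy : ∀ q : Q, (q, 1) ∈ H := by
      have : Subgroup.closure {x, y} ≤ H.comap (MonoidHom.inl Q (Multiplicative (ZMod (p ^ 3)))) := by
        rw [Subgroup.closure_le]
        rintro w (rfl | rfl)
        · exact Ideal.mem_sup_left (Ideal.mem_sup_left (Ideal.mem_span_singleton_self _))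
        · exact Ideal.mem_sup_left (Ideal.mem_sup_right (Ideal.mem_span_singleton_self _))
      intro q
      exact this (hgen ▸ Subgroup.mem_top q)
    have hz1 : (1, z) ∈ H := Ideal.mem_sup_right (Ideal.mem_span_singleton_self _)
    have hzz : ∀ w : Multiplicative (ZMod (p ^ 3)), (1, w) ∈ H := by
      intro w
      haveI : NeZero (p ^ 3) := ⟨by positivity⟩
      have hw : w = z ^ (ZMod.val (Multiplicative.toAdd w)) := by
        simp only [z, ← ofAdd_nsmul, nsmul_eq_mul, mul_one, ZMod.natCast_zmod_val, ofAdd_toAdd]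
      rw [hw]
      have h := H.pow_mem hz1 (ZMod.val (Multiplicative.toAdd w))
      rwa [Prod.pow_mk, one_pow] at h
    rintro ⟨q, w⟩
    have := H.mul_mem (hxy q) (hzz w)
    rw [Prod.mk_mul_mk, mul_one, one_mul] at this
    exact this
  let g : ι → A := fun i => (f i, z)
  have hprod : ∏ i, (1 + - o (g i)) = 0 := by
    have : ∏ i : ι, (1 + - o (g i)) ∈ ∏ i : ι, I := by
      apply Ideal.prod_mem_prod
      intro i _
      have := I.neg_mem (hH (g i))
      rwa [neg_sub, sub_eq_add_neg] at this
    rw [Finset.prod_const, Finset.card_univ, hN, hI] at this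
    simpa using this
  rw [Finset.prod_one_add] at hprod
  by_contra hcon
  push Not at hcon
  have hterm : ∀ t : Finset ι, (∏ i ∈ t, - o (g i)) =
      MonoidAlgebra.single (∏ i ∈ t, g i) ((-1 : ZMod p) ^ t.card) := by
    intro t
    rw [Finset.prod_neg, ← map_prod]
    have h : ((-1 : R) ^ t.card) = MonoidAlgebra.single 1 ((-1 : ZMod p) ^ t.card) := by
      rw [show (-1 : R) = MonoidAlgebra.single 1 (-1 : ZMod p) by
        rw [MonoidAlgebra.single_neg]; rfl, MonoidAlgebra.single_pow, one_pow]
    rw [h]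
    change MonoidAlgebra.single 1 _ * MonoidAlgebra.single _ 1 = _
    rw [MonoidAlgebra.single_mul_single, one_mul, mul_one]
  have hne : ∀ t : Finset ι, t ≠ ∅ → ∏ i ∈ t, g i ≠ 1 := by
    intro t ht h
    have ha : ∏ i ∈ t, f i = 1 := by
      have := congrArg Prod.fst h
      rw [Prod.fst_prod] at this
      exact this
    have hb : z ^ t.card = 1 := by
      have := congrArg Prod.snd h
      rw [Prod.snd_prod, Finset.prod_const] at this
      exact this
    have hc : p ^ 3 ∣ t.card := by
      simp only [z, ← ofAdd_nsmul, nsmul_eq_mul, mul_one] at hb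
      exact (ZMod.natCast_eq_zero_iff _ _).1 (ofAdd_eq_one.1 hb)
    have hle : t.card ≤ p ^ 3 + 3 * p - 3 := hN ▸ Finset.card_le_univ t
    have hpos : 0 < t.card := Finset.card_pos.2 (Finset.nonempty_iff_ne_empty.2 ht)
    obtain ⟨k, hk⟩ := hc
    have h9 : 3 * p ≤ p ^ 3 := by nlinarith [mul_le_mul hp3 hp3 (by omega) (by omega)]
    have : k = 1 := by
      rcases k with _ | _ | k
      · rw [mul_zero] at hk; omega
      · rfl
      · exfalso
        have : p ^ 3 * (k + 1 + 1) = p ^ 3 * k + p ^ 3 + p ^ 3 := by ring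
        have : 0 ≤ p ^ 3 * k := Nat.zero_le _
        omega
    subst this
    exact hcon t (by simpa using hk) ha
  have hev := congrArg (fun r : R => r.coeff 1) hprod
  simp only [hterm] at hev
  rw [← Finset.sum_erase_add _ _ (Finset.empty_mem_powerset (Finset.univ : Finset ι))] at hev
  have h0 : (∑ t ∈ (Finset.univ : Finset ι).powerset.erase ∅,
     (MonoidAlgebra.single (∏ i ∈ t, g i) ((-1 : ZMod p) ^ t.card) : R)).coeff 1 = 0 := by
    rw [MonoidAlgebra.coeff_sum, Finsupp.finsetSum_apply]
    apply Finset.sum_eq_zero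
    intro t ht
    simp [MonoidAlgebra.coeff_single, Finsupp.single_apply, hne t (Finset.ne_of_mem_erase ht)]
  rw [MonoidAlgebra.coeff_add, Finsupp.add_apply, h0] at hev
  simp at hev

theorem stmt_11 (p : ℕ) (hp : p.Prime) (hodd : Odd p)
    {G : Type*} [Group G] [Fintype G]
    (hcard : Fintype.card G = p ^ 3)
    (hexp : Monoid.exponent G = p)
    (hna : ∃ a b : G, a * b ≠ b * a)
    (W : Multiset G) (hlen : Multiset.card W = p ^ 3 + 3 * p - 3) :
    ∃ l : List G, (l : Multiset G) ≤ W ∧ l.length = p ^ 3 ∧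
      l.prod ∈ Subgroup.center G := by
  classical
  haveI : Fact p.Prime := ⟨hp⟩
  have hp3 : 3 ≤ p := by
    have := hp.two_le
    obtain ⟨k, hk⟩ := hodd
    omega
  have hG : Nat.card G = p ^ 3 := by rw [Nat.card_eq_fintype_card, hcard]
  have hpg : IsPGroup p G := IsPGroup.of_card hG
  let Z := Subgroup.center G
  have hncyc : ¬ IsCyclic (G ⧸ Z) := by
    intro h
    obtain ⟨a, b, hab⟩ := hna
    exact hab (commutative_of_cyclic_center_quotient (QuotientGroup.mk' Z) (by simp [Z]) a b)
  haveI : Nontrivial G := by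
    obtain ⟨a, b, hab⟩ := hna
    exact ⟨_, _, hab⟩
  have hZ : p ∣ Nat.card Z := by
    haveI := hpg.center_nontrivial
    obtain ⟨n, hn, h⟩ := (hpg.to_subgroup Z).nontrivial_iff_card.1 this
    rw [h]
    exact dvd_pow_self p hn.ne'
  have hmul : Nat.card G = Nat.card (G ⧸ Z) * Nat.card Z := Subgroup.card_eq_card_quotient_mul_card_subgroup Z
  have hQ : Nat.card (G ⧸ Z) = p ^ 2 := by
    obtain ⟨k, hk⟩ := hZ
    have h1 : Nat.card (G ⧸ Z) * k = p ^ 2 := by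
      apply Nat.eq_of_mul_eq_mul_left hp.pos
      rw [hG, hk] at hmul
      linarith [hmul, show p ^ 3 = p * p ^ 2 by ring, show Nat.card (G ⧸ Z) * (p * k) = p * (Nat.card (G ⧸ Z) * k) by ring]
    obtain ⟨j, hj, h⟩ := (Nat.dvd_prime_pow hp).1 (Dvd.intro _ h1)
    interval_cases j
    · exact absurd (by
        haveI : Subsingleton (G ⧸ Z) := (Nat.card_eq_one_iff_unique.1 (by simpa using h)).1
        infer_instance) hncyc
    · exact absurd (isCyclic_of_prime_card (p := p) (by simpa using h)) hncyc
    · exact h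
  letI : CommGroup (G ⧸ Z) :=
    { (inferInstance : Group (G ⧸ Z)) with
      mul_comm := (IsPGroup.isMulCommutative_of_card_eq_prime_sq hQ).is_comm.comm }
  have hpow : ∀ q : G ⧸ Z, q ^ p = 1 := by
    intro q
    obtain ⟨a, rfl⟩ := QuotientGroup.mk_surjective q
    have : a ^ p = 1 := hexp ▸ Monoid.pow_exponent_eq_one a
    rw [← QuotientGroup.mk_pow, this]; rfl
  have hgen : ∃ x y : G ⧸ Z, Subgroup.closure {x, y} = ⊤ := by
    haveI : Nontrivial (G ⧸ Z) := by
      by_contra h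
      rw [not_nontrivial_iff_subsingleton] at h
      exact hncyc inferInstance
    obtain ⟨x, hx⟩ := exists_ne (1 : G ⧸ Z)
    have : ∃ y, y ∉ Subgroup.zpowers x := by
      by_contra h
      push Not at h
      exact hncyc ⟨x, h⟩
    obtain ⟨y, hy⟩ := this
    refine ⟨x, y, ?_⟩
    have hle : Subgroup.zpowers x < Subgroup.closure {x, y} := by
      refine lt_of_le_of_ne ?_ ?_
      · rw [Subgroup.zpowers_le]; exact Subgroup.subset_closure (by simp)
      · intro h
        exact hy (h ▸ Subgroup.subset_closure (by simp))
    have hcx : Nat.card (Subgroup.zpowers x) = p := by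
      rw [Nat.card_zpowers]; exact orderOf_eq_prime (hpow x) hx
    have hlt : p < Nat.card (Subgroup.closure {x, y}) := by
      by_contra h
      push Not at h
      exact hle.ne (Subgroup.eq_of_le_of_card_ge hle.le (by rw [hcx]; exact h))
    have hd : Nat.card (Subgroup.closure {x, y}) ∣ p ^ 2 := hQ ▸ Subgroup.card_subgroup_dvd_card _
    obtain ⟨j, hj, h⟩ := (Nat.dvd_prime_pow hp).1 hd
    apply Subgroup.eq_top_of_card_eq
    rw [hQ, h]
    interval_cases j
    · rw [h, pow_zero] at hlt; omega
    · rw [h] at hlt; simp at hlt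
    · rfl
  obtain ⟨x, y, hxy⟩ := hgen
  obtain ⟨L, rfl⟩ := Quot.exists_rep W
  have hL : L.length = p ^ 3 + 3 * p - 3 := by simpa using hlen
  obtain ⟨S, hS, hS1⟩ := key_aux p hp3 x y (hpow x) (hpow y) hxy
    (fun i : Fin L.length => (QuotientGroup.mk' Z (L.get i))) (by simpa using hL)
  refine ⟨S.toList.map L.get, ?_, by simpa using hS, ?_⟩
  · have h1 : ((S.toList.map L.get : List G) : Multiset G) = S.val.map L.get := by
      rw [← Multiset.map_coe, Finset.coe_toList]
    have h2 : (Quot.mk _ L : Multiset G) = (Finset.univ : Finset (Fin L.length)).val.map L.get := by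
      rw [Fin.univ_val_map, List.ofFn_get]; rfl
    rw [h1, h2]
    exact Multiset.map_le_map (Finset.val_le_iff.2 (Finset.subset_univ S))
  · have : QuotientGroup.mk' Z (S.toList.map L.get).prod = 1 := by
      rw [map_list_prod, List.map_map, ← hS1, ← Finset.prod_map_toList]
      rfl
    exact (QuotientGroup.eq_one_iff _).1 this
end

section
/- Let $G$ be the non-abelian group of order $27$ and exponent $3$. Every sequence of length $7$ over $G$ contains a nonempty subsequence whose terms, in some order, multiply to the identity. Consequently, the small Davenport constant satisfies $\mathsf{d}(G) = 6$. -/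
/-- A sequence (multiset) over `G` has a product-one subsequence if some nonempty
list of its terms (a sub-multiset) multiplies to the identity. -/
def HasProdOneSubseq {G : Type*} [Group G] (S : Multiset G) : Prop :=
  ∃ l : List G, l ≠ [] ∧ (l : Multiset G) ≤ S ∧ l.prod = 1

/-- The small Davenport constant: the maximal length of a sequence over `G`
with no nonempty product-one subsequence. -/
noncomputable def smallDavenport (G : Type*) [Group G] : ℕ :=
  sSup {n | ∃ S : Multiset G, Multiset.card S = n ∧ ¬ HasProdOneSubseq S}

namespace Heis27

/-- Codes: `9 i + 3 j + k` stands for `a^i b^j c^k`, where `b a = a b c`. -/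
def mulC (m n : ℕ) : ℕ :=
  ((m / 9 + n / 9) % 3) * 9 + ((m / 3 % 3 + n / 3 % 3) % 3) * 3
    + (m % 3 + n % 3 + (m / 3 % 3) * (n / 9)) % 3

def invC (m : ℕ) : ℕ :=
  ((2 * (m / 9)) % 3) * 9 + ((2 * (m / 3 % 3)) % 3) * 3
    + (2 * (m % 3) + (m / 9) * (m / 3 % 3)) % 3

/-- Forces evaluation of a numeral. -/
def force {α : Type} (n : ℕ) (f : ℕ → α) : α :=
  Nat.rec (f 0) (fun m _ => f (m + 1)) n

theorem force_eq {α : Type} (n : ℕ) (f : ℕ → α) : force n f = f n := by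
  cases n <;> rfl

def mk (f : ℕ → Bool) : ℕ → ℕ
  | 0 => 0
  | n + 1 => cond (f n) (mk f n + 2 ^ n) (mk f n)

theorem mk_lt (f : ℕ → Bool) (n : ℕ) : mk f n < 2 ^ n := by
  induction n with
  | zero => simp [mk]
  | succ n ih =>
    rw [mk, pow_succ]
    cases f n <;> simp <;> omega

theorem mk_test (f : ℕ → Bool) (n i : ℕ) (h : (mk f n).testBit i = true) : f i = true := by
  induction n with
  | zero => simp [mk] at h
  | succ n ih =>
    rw [mk] at h
    cases hf : f n with
    | false => rw [hf] at h; exact ih h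
    | true =>
      rw [hf] at h
      simp only [cond_true] at h
      rw [Nat.add_comm] at h
      rcases lt_trichotomy i n with hi | hi | hi
      · rw [Nat.testBit_two_pow_add_gt hi] at h; exact ih h
      · rw [hi]; exact hf
      · exfalso
        have := mk_lt f n
        have h2 : 2 ^ n + mk f n < 2 ^ i :=
          lt_of_lt_of_le (by rw [pow_succ]; omega) (Nat.pow_le_pow_right (by norm_num) hi)
        rw [Nat.testBit_lt_two_pow h2] at h
        exact absurd h (by simp)

def step (g P : ℕ) : ℕ :=
  force (invC g) fun gi =>
    mk (fun i => P.testBit i || (P.testBit (mulC gi i) || P.testBit (mulC i gi))) 27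

def inner (rec : List ℕ → ℕ → Bool) : List ℕ → ℕ → Bool
  | [], _ => true
  | g :: gs, P =>
    (P.testBit (invC g) || force (step g P) fun P' => rec (g :: gs) P') && inner rec gs P

def search : ℕ → List ℕ → ℕ → Bool
  | 0 => fun _ _ => false
  | n + 1 => inner (search n)

def alphA : List ℕ := List.range 27
def alphB : List ℕ := [0, 1, 2, 9, 10, 11, 18, 19, 20]

theorem searchA : search 5 alphA (step 3 (step 9 1)) = true := by decide +kernel
theorem searchB : search 7 alphB 1 = true := by decide +kernel

theorem inv_code : ∀ n < 27, mulC n (invC n) = 0 := by decide +kernel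
theorem comm_code : ∀ n < 27, mulC n 9 = mulC 9 n → n ∈ alphB := by decide +kernel
theorem alphB_lt : ∀ n ∈ alphB, n < 27 := by decide

section grp
variable {G : Type*} [Group G]

def phi (a b c : G) (n : ℕ) : G := a ^ (n / 9) * b ^ (n / 3 % 3) * c ^ (n % 3)

structure Good (a b c : G) : Prop where
  a3 : a ^ 3 = 1
  b3 : b ^ 3 = 1
  c3 : c ^ 3 = 1
  ba : b * a = a * b * c
  cen : ∀ g, c * g = g * c

variable {a b c : G}

theorem Good.cpow (h : Good a b c) (n : ℕ) (g : G) : c ^ n * g = g * c ^ n :=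
  ((show Commute c g from h.cen g).pow_left n).eq

theorem Good.bpow_a (h : Good a b c) (j : ℕ) : b ^ j * a = a * b ^ j * c ^ j := by
  induction j with
  | zero => simp
  | succ j ih =>
    calc b ^ (j + 1) * a = b ^ j * (b * a) := by rw [pow_succ, mul_assoc]
      _ = (b ^ j * a) * b * c := by rw [h.ba]; simp only [mul_assoc]
      _ = a * b ^ j * (c ^ j * b) * c := by rw [ih]; simp only [mul_assoc]
      _ = a * b ^ (j + 1) * c ^ (j + 1) := by
        rw [h.cpow, pow_succ b, pow_succ c]; simp only [mul_assoc]

theorem Good.bpow_apow (h : Good a b c) (j p : ℕ) :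
    b ^ j * a ^ p = a ^ p * b ^ j * c ^ (j * p) := by
  induction p with
  | zero => simp
  | succ p ih =>
    calc b ^ j * a ^ (p + 1) = (b ^ j * a ^ p) * a := by rw [pow_succ, mul_assoc]
      _ = a ^ p * b ^ j * (c ^ (j * p) * a) := by rw [ih]; simp only [mul_assoc]
      _ = a ^ p * (b ^ j * a) * c ^ (j * p) := by rw [h.cpow]; simp only [mul_assoc]
      _ = a ^ p * a * b ^ j * (c ^ j * c ^ (j * p)) := by rw [h.bpow_a]; simp only [mul_assoc]
      _ = a ^ (p + 1) * b ^ j * c ^ (j * (p + 1)) := by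
        rw [← pow_succ, ← pow_add]; congr 2; ring

theorem Good.mul_formula (h : Good a b c) (i j k p q r : ℕ) :
    (a ^ i * b ^ j * c ^ k) * (a ^ p * b ^ q * c ^ r)
      = a ^ (i + p) * b ^ (j + q) * c ^ (k + r + j * p) := by
  calc (a ^ i * b ^ j * c ^ k) * (a ^ p * b ^ q * c ^ r)
      = a ^ i * b ^ j * (c ^ k * (a ^ p * b ^ q)) * c ^ r := by simp only [mul_assoc]
    _ = a ^ i * (b ^ j * a ^ p) * b ^ q * c ^ k * c ^ r := by
        rw [h.cpow]; simp only [mul_assoc]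
    _ = a ^ i * a ^ p * b ^ j * (c ^ (j * p) * b ^ q) * c ^ k * c ^ r := by
        rw [h.bpow_apow]; simp only [mul_assoc]
    _ = (a ^ i * a ^ p) * (b ^ j * b ^ q) * (c ^ (j * p) * c ^ k * c ^ r) := by
        rw [h.cpow]; simp only [mul_assoc]
    _ = _ := by
        rw [← pow_add, ← pow_add, ← pow_add, ← pow_add]; congr 2; ring

theorem phi_code (h : Good a b c) (i j k : ℕ) :
    phi a b c ((i % 3) * 9 + (j % 3) * 3 + k % 3) = a ^ i * b ^ j * c ^ k := by
  unfold phi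
  have h1 : ((i % 3) * 9 + (j % 3) * 3 + k % 3) / 9 = i % 3 := by omega
  have h2 : ((i % 3) * 9 + (j % 3) * 3 + k % 3) / 3 % 3 = j % 3 := by omega
  have h3 : ((i % 3) * 9 + (j % 3) * 3 + k % 3) % 3 = k % 3 := by omega
  rw [h1, h2, h3, ← pow_eq_pow_mod i h.a3, ← pow_eq_pow_mod j h.b3, ← pow_eq_pow_mod k h.c3]

theorem phi_mul (h : Good a b c) (m n : ℕ) :
    phi a b c (mulC m n) = phi a b c m * phi a b c n := by
  unfold mulC
  rw [phi_code h, phi, phi, h.mul_formula]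

theorem phi_zero : phi a b c 0 = 1 := by simp [phi]

theorem phi_inv (h : Good a b c) (n : ℕ) (hn : n < 27) :
    phi a b c (invC n) = (phi a b c n)⁻¹ := by
  rw [eq_inv_iff_mul_eq_one, mul_eq_one_comm, ← phi_mul h, inv_code n hn, phi_zero]

def Inv (a b c : G) (S : Multiset G) (P : ℕ) : Prop :=
  ∀ i, P.testBit i = true → ∃ l : List G, (l : Multiset G) ≤ S ∧ l.prod = phi a b c i

theorem inv_one : Inv a b c 0 1 := by
  intro i hi
  have : i = 0 := by
    rcases Nat.eq_zero_or_pos i with h | h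
    · exact h
    · rw [Nat.testBit_lt_two_pow (Nat.one_lt_two_pow h.ne')] at hi; simp at hi
  subst this
  exact ⟨[], by simp, by simp [phi_zero]⟩

theorem inv_step (h : Good a b c) {S : Multiset G} {P : ℕ} (hP : Inv a b c S P) (g : ℕ)
    (hg : g < 27) : Inv a b c (phi a b c g ::ₘ S) (step g P) := by
  intro i hi
  rw [step, force_eq] at hi
  have := mk_test _ _ _ hi
  simp only [Bool.or_eq_true] at this
  rcases this with h1 | h1 | h1
  · obtain ⟨l, hl, hp⟩ := hP _ h1
    exact ⟨l, hl.trans (Multiset.le_cons_self _ _), hp⟩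
  · obtain ⟨l, hl, hp⟩ := hP _ h1
    refine ⟨phi a b c g :: l, ?_, ?_⟩
    · rw [← Multiset.cons_coe]; exact Multiset.cons_le_cons _ hl
    · rw [List.prod_cons, hp, phi_mul h, phi_inv h g hg]; simp
  · obtain ⟨l, hl, hp⟩ := hP _ h1
    refine ⟨l ++ [phi a b c g], ?_, ?_⟩
    · rw [← Multiset.coe_add, Multiset.coe_singleton, add_comm, Multiset.singleton_add]
      exact Multiset.cons_le_cons _ hl
    · rw [List.prod_append, hp, phi_mul h, phi_inv h g hg]; simp

theorem has_mono {S T : Multiset G} (hST : S ≤ T) (h : HasProdOneSubseq S) :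
    HasProdOneSubseq T := by
  obtain ⟨l, h1, h2, h3⟩ := h
  exact ⟨l, h1, h2.trans hST, h3⟩

theorem search_sound (h : Good a b c) (n : ℕ) : ∀ (al : List ℕ) (P : ℕ) (S : Multiset G)
    (T : Multiset ℕ), (∀ x ∈ al, x < 27) → search n al P = true → Inv a b c S P →
    (∀ t ∈ T, t ∈ al) → Multiset.card T = n → HasProdOneSubseq (S + T.map (phi a b c)) := by
  induction n with
  | zero => intro al P S T _ hs; simp [search] at hs
  | succ n ih =>
    intro al
    induction al with
    | nil =>
      intro P S T _ _ _ hT hc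
      obtain ⟨t, ht⟩ := Multiset.card_pos_iff_exists_mem.mp (by omega : 0 < Multiset.card T)
      exact absurd (hT t ht) (by simp)
    | cons g gs ihl =>
      intro P S T hal hs hP hT hc
      rw [search, inner, Bool.and_eq_true, Bool.or_eq_true, force_eq] at hs
      obtain ⟨hs1, hs2⟩ := hs
      have hg : g < 27 := hal g (by simp)
      by_cases hgT : g ∈ T
      · obtain ⟨T', rfl⟩ := Multiset.exists_cons_of_mem hgT
        rw [Multiset.map_cons, Multiset.add_cons, ← Multiset.cons_add]
        rcases hs1 with hs1 | hs1
        · obtain ⟨l, hl, hp⟩ := hP _ hs1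
          refine has_mono (Multiset.le_add_right _ _) ⟨phi a b c g :: l, by simp, ?_, ?_⟩
          · rw [← Multiset.cons_coe]; exact Multiset.cons_le_cons _ hl
          · rw [List.prod_cons, hp, phi_inv h g hg, mul_inv_cancel]
        · refine ih _ _ _ T' hal hs1 (inv_step h hP g hg) ?_ ?_
          · intro t ht; exact hT t (Multiset.mem_cons_of_mem ht)
          · simpa using hc
      · refine ihl P S T (fun x hx => hal x (by simp [hx])) hs2 hP ?_ hc
        intro t ht
        rcases List.mem_cons.mp (hT t ht) with rfl | h'
        · exact absurd ht hgT
        · exact h'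

end grp

section fin
variable {G : Type*} [Group G] [Fintype G]

theorem pow3 (hexp : Monoid.exponent G = 3) (g : G) : g ^ 3 = 1 := by
  rw [← hexp]; exact Monoid.pow_exponent_eq_one g

theorem comm_center (hcard : Fintype.card G = 27) (hna : ∃ a b : G, a * b ≠ b * a)
    (a b g : G) : (a⁻¹ * b⁻¹ * a * b) * g = g * (a⁻¹ * b⁻¹ * a * b) := by
  have : Fact (Nat.Prime 3) := ⟨by norm_num⟩
  have hN : Nat.card G = 3 ^ 3 := by rw [Nat.card_eq_fintype_card, hcard]; norm_num
  have hp : IsPGroup 3 G := IsPGroup.of_card hN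
  have hidx := (Subgroup.center G).card_mul_index
  have hq : (Subgroup.center G).index = Nat.card (G ⧸ Subgroup.center G) := rfl
  obtain ⟨k, hk, hk'⟩ := (Nat.dvd_prime_pow (by norm_num : Nat.Prime 3)).mp
    (hN ▸ (Subgroup.center G).index_dvd_card)
  have hnc : ¬ IsCyclic (G ⧸ Subgroup.center G) := by
    intro hc
    obtain ⟨x, y, hxy⟩ := hna
    exact hxy (commutative_of_cyclic_center_quotient (QuotientGroup.mk' (Subgroup.center G))
      (by simp) x y)
  have hG : Nontrivial G := by
    obtain ⟨x, y, hxy⟩ := hna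
    exact ⟨_, _, hxy⟩
  have hz : 1 < Nat.card (Subgroup.center G) := by
    have := hp.center_nontrivial
    exact Finite.one_lt_card
  have hk2 : k = 2 := by
    interval_cases k
    · exfalso; apply hnc
      have : Subsingleton (G ⧸ Subgroup.center G) :=
        (Nat.card_eq_one_iff_unique.mp (by rw [← hq, hk']; norm_num)).1
      infer_instance
    · exfalso; apply hnc
      exact isCyclic_of_prime_card (p := 3) (by rw [← hq, hk']; norm_num)
    · rfl
    · exfalso
      rw [hk', hN] at hidx
      omega
  subst hk2
  have hcomm := IsPGroup.commutative_of_card_eq_prime_sq (p := 3)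
    (G := G ⧸ Subgroup.center G) (by rw [← hq, hk'])
  have hmem : a⁻¹ * b⁻¹ * a * b ∈ Subgroup.center G := by
    rw [← QuotientGroup.eq_one_iff]
    have := hcomm (a : G ⧸ Subgroup.center G) b
    change (a : G ⧸ Subgroup.center G)⁻¹ * (b : G ⧸ Subgroup.center G)⁻¹ * a * b = 1
    rw [mul_assoc, this]
    group
  exact (Subgroup.mem_center_iff.mp hmem g).symm

theorem good (hcard : Fintype.card G = 27) (hexp : Monoid.exponent G = 3)
    (hna : ∃ a b : G, a * b ≠ b * a) (a b : G) :
    Good a b (b⁻¹ * a⁻¹ * b * a) where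
  a3 := pow3 hexp _
  b3 := pow3 hexp _
  c3 := pow3 hexp _
  ba := by group
  cen := comm_center hcard hna b a

/-- The image of `phi` is everything. -/
theorem phi_surj (hcard : Fintype.card G = 27) (hexp : Monoid.exponent G = 3)
    {a b c : G} (h : Good a b c) (hab : a * b ≠ b * a) (g : G) :
    ∃ n < 27, phi a b c n = g := by
  have : Fact (Nat.Prime 3) := ⟨by norm_num⟩
  have hlt : ∀ m n, mulC m n < 27 := by intro m n; unfold mulC; omega
  let K : Subgroup G :=
    { carrier := {g | ∃ n < 27, phi a b c n = g}
      one_mem' := ⟨0, by norm_num, phi_zero⟩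
      mul_mem' := by
        rintro x y ⟨m, _, rfl⟩ ⟨n, _, rfl⟩
        exact ⟨mulC m n, hlt _ _, phi_mul h m n⟩
      inv_mem' := by
        rintro x ⟨m, hm, rfl⟩
        exact ⟨invC m, by unfold invC; omega, phi_inv h m hm⟩ }
  have ha : a ∈ K := ⟨9, by norm_num, by simp [phi]⟩
  have hb : b ∈ K := ⟨3, by norm_num, by simp [phi]⟩
  have hN : Nat.card G = 3 ^ 3 := by rw [Nat.card_eq_fintype_card, hcard]; norm_num
  obtain ⟨k, hk, hk'⟩ := (Nat.dvd_prime_pow (by norm_num : Nat.Prime 3)).mp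
    (hN ▸ K.card_subgroup_dvd_card)
  have hncK : ¬ ∀ x y : K, x * y = y * x := by
    intro hc
    exact hab (congrArg Subtype.val (hc ⟨a, ha⟩ ⟨b, hb⟩))
  have hk3 : k = 3 := by
    interval_cases k
    · exfalso; apply hncK
      have : Subsingleton K := (Nat.card_eq_one_iff_unique.mp (by rw [hk']; norm_num)).1
      intro x y; exact Subsingleton.elim _ _
    · exfalso; apply hncK
      have : IsCyclic K := isCyclic_of_prime_card (p := 3) (by rw [hk']; norm_num)
      intro x y
      exact (IsCyclic.isMulCommutative (α := K)).is_comm.comm x y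
    · exfalso; apply hncK
      exact IsPGroup.commutative_of_card_eq_prime_sq (p := 3) hk'
    · rfl
  subst hk3
  have hT : K = ⊤ := Subgroup.eq_top_of_card_eq K (by rw [hk', hN])
  have hgK : g ∈ K := hT ▸ Subgroup.mem_top g
  exact hgK

theorem phi_inj (hcard : Fintype.card G = 27) (hexp : Monoid.exponent G = 3)
    {a b c : G} (h : Good a b c) (hab : a * b ≠ b * a) {m n : ℕ} (hm : m < 27) (hn : n < 27)
    (hmn : phi a b c m = phi a b c n) : m = n := by
  let f : Fin 27 → G := fun i => phi a b c i
  have hs : Function.Surjective f := by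
    intro g
    obtain ⟨n, hn, hg⟩ := phi_surj hcard hexp h hab g
    exact ⟨⟨n, hn⟩, hg⟩
  have hb : Function.Bijective f :=
    (Fintype.bijective_iff_surjective_and_card f).mpr ⟨hs, by simp [hcard]⟩
  have := @hb.1 ⟨m, hm⟩ ⟨n, hn⟩ hmn
  exact congrArg Fin.val this

theorem exists_codes {a b c : G} (al : List ℕ) (S : Multiset G)
    (hS : ∀ g ∈ S, ∃ n ∈ al, phi a b c n = g) :
    ∃ T : Multiset ℕ, (∀ t ∈ T, t ∈ al) ∧ T.map (phi a b c) = S := by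
  induction S using Multiset.induction_on with
  | empty => exact ⟨0, by simp, by simp⟩
  | cons g S ih =>
    obtain ⟨T, h1, h2⟩ := ih (fun x hx => hS x (Multiset.mem_cons_of_mem hx))
    obtain ⟨n, hn, hg⟩ := hS g (Multiset.mem_cons_self _ _)
    refine ⟨n ::ₘ T, ?_, by simp [hg, h2]⟩
    intro t ht
    rcases Multiset.mem_cons.mp ht with rfl | ht
    · exact hn
    · exact h1 t ht

theorem main7 (hcard : Fintype.card G = 27) (hexp : Monoid.exponent G = 3)
    (hna : ∃ a b : G, a * b ≠ b * a) (S : Multiset G) (hS : Multiset.card S = 7) :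
    HasProdOneSubseq S := by
  by_cases hA : ∃ a ∈ S, ∃ b ∈ S, a * b ≠ b * a
  · obtain ⟨a, ha, b, hb, hab⟩ := hA
    have h := good hcard hexp hna a b
    set c := b⁻¹ * a⁻¹ * b * a with hc
    obtain ⟨S1, rfl⟩ := Multiset.exists_cons_of_mem ha
    have hb1 : b ∈ S1 := by
      rcases Multiset.mem_cons.mp hb with rfl | hb
      · exact absurd rfl hab
      · exact hb
    obtain ⟨S2, rfl⟩ := Multiset.exists_cons_of_mem hb1
    obtain ⟨T, hT, rfl⟩ := exists_codes (a := a) (b := b) (c := c) alphA S2 (by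
      intro g _
      obtain ⟨n, hn, hg⟩ := phi_surj hcard hexp h hab g
      exact ⟨n, by simp [alphA, hn], hg⟩)
    have hI := inv_step h (inv_step h (inv_one (a := a) (b := b) (c := c)) 9 (by norm_num)) 3
      (by norm_num)
    have h9 : phi a b c 9 = a := by simp [phi]
    have h3 : phi a b c 3 = b := by simp [phi]
    have := search_sound h 5 alphA _ _ T (by simp [alphA]) searchA hI hT (by simpa using hS)
    rw [h9, h3] at this
    refine has_mono (le_of_eq ?_) this
    simp only [Multiset.cons_add, zero_add]
    exact Multiset.cons_swap _ _ _
  · push Not at hA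
    have key : ∃ a b : G, a * b ≠ b * a ∧ ∀ g ∈ S, g * a = a * g := by
      by_cases hB : ∃ a ∈ S, ∃ b, a * b ≠ b * a
      · obtain ⟨a, ha, b, hab⟩ := hB
        exact ⟨a, b, hab, fun g hg => hA g hg a ha⟩
      · push Not at hB
        obtain ⟨a, b, hab⟩ := hna
        exact ⟨a, b, hab, fun g hg => hB g hg a⟩
    obtain ⟨a, b, hab, hS'⟩ := key
    have h := good hcard hexp hna a b
    set c := b⁻¹ * a⁻¹ * b * a with hc
    have h9 : phi a b c 9 = a := by simp [phi]
    obtain ⟨T, hT, rfl⟩ := exists_codes (a := a) (b := b) (c := c) alphB S (by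
      intro g hg
      obtain ⟨n, hn, rfl⟩ := phi_surj hcard hexp h hab g
      refine ⟨n, comm_code n hn ?_, rfl⟩
      apply phi_inj hcard hexp h hab
      · unfold mulC; omega
      · unfold mulC; omega
      · rw [phi_mul h, phi_mul h, h9]; exact hS' _ hg)
    have := search_sound h 7 alphB _ _ T alphB_lt searchB
      (inv_one (a := a) (b := b) (c := c)) hT (by simpa using hS)
    simpa using this

theorem list_form {a b c : G} (h : Good a b c) (hab : a ≠ b) (hac : a ≠ c) (hbc : b ≠ c)
    [DecidableEq G] (l : List G) (hl : ∀ g ∈ l, g = a ∨ g = b ∨ g = c) :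
    ∃ k, l.prod = a ^ l.count a * b ^ l.count b * c ^ k := by
  induction l with
  | nil => exact ⟨0, by simp⟩
  | cons g l ih =>
    obtain ⟨k, hk⟩ := ih (fun x hx => hl x (List.mem_cons_of_mem _ hx))
    rw [List.prod_cons, hk]
    rcases hl g List.mem_cons_self with rfl | rfl | rfl
    · refine ⟨k, ?_⟩
      rw [List.count_cons_self, List.count_cons_of_ne hab, pow_succ']
      simp only [mul_assoc]
    · have := h.mul_formula 0 1 0 (l.count a) (l.count g) k
      simp only [pow_zero, pow_one, one_mul, mul_one] at this
      rw [this, List.count_cons_self, List.count_cons_of_ne hab.symm]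
      refine ⟨0 + k + l.count a, ?_⟩
      rw [zero_add (l.count a), add_comm 1 (l.count g)]
    · refine ⟨k + 1, ?_⟩
      rw [h.cen, List.count_cons_of_ne hac.symm, List.count_cons_of_ne hbc.symm, pow_succ]
      simp only [mul_assoc]

theorem free6 (hcard : Fintype.card G = 27) (hexp : Monoid.exponent G = 3)
    (hna : ∃ a b : G, a * b ≠ b * a) :
    ∃ S : Multiset G, Multiset.card S = 6 ∧ ¬ HasProdOneSubseq S := by
  classical
  obtain ⟨a, b, hab⟩ := id hna
  have h := good hcard hexp hna a b
  generalize b⁻¹ * a⁻¹ * b * a = c at h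
  have hne1 : a ≠ b := by rintro rfl; exact hab rfl
  have hne2 : a ≠ c := by rintro rfl; exact hab (h.cen b)
  have hne3 : b ≠ c := by rintro rfl; exact hab (h.cen a).symm
  refine ⟨([a, a, b, b, c, c] : List G), by simp, ?_⟩
  rintro ⟨l, hl0, hle, hprod⟩
  have hmem : ∀ g ∈ l, g = a ∨ g = b ∨ g = c := by
    intro g hg
    have := Multiset.mem_of_le hle (Multiset.mem_coe.mpr hg)
    simp at this
    tauto
  have hcnt : ∀ g, l.count g ≤ [a, a, b, b, c, c].count g := by
    intro g
    have := Multiset.count_le_of_le g hle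
    simpa only [Multiset.coe_count] using this
  have ca : l.count a ≤ 2 := by
    simpa [List.count_cons, hne1.symm, hne2.symm] using hcnt a
  have cb : l.count b ≤ 2 := by
    simpa [List.count_cons, hne1, hne3.symm] using hcnt b
  have cc : l.count c ≤ 2 := by
    simpa [List.count_cons, hne2, hne3] using hcnt c
  have zero : ∀ i j k, a ^ i * b ^ j * c ^ k = 1 → i % 3 = 0 ∧ j % 3 = 0 ∧ k % 3 = 0 := by
    intro i j k hh
    rw [← phi_code h, ← phi_zero (a := a) (b := b) (c := c)] at hh
    have := phi_inj hcard hexp h hab (by omega) (by norm_num) hh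
    omega
  obtain ⟨k, hk⟩ := list_form h hne1 hne2 hne3 l hmem
  rw [hprod] at hk
  obtain ⟨za, zb, -⟩ := zero _ _ _ hk.symm
  have na : a ∉ l := List.count_eq_zero.mp (by omega)
  have nb : b ∉ l := List.count_eq_zero.mp (by omega)
  have hall : ∀ g ∈ l, g = c := by
    intro g hg
    rcases hmem g hg with rfl | rfl | rfl
    · exact absurd hg na
    · exact absurd hg nb
    · rfl
  have hrep := List.eq_replicate_of_mem hall
  rw [hrep, List.count_replicate_self] at cc
  rw [hrep, List.prod_replicate] at hprod
  obtain ⟨-, -, zc⟩ := zero 0 0 l.length (by simpa using hprod)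
  exact hl0 (List.length_eq_zero_iff.mp (by omega))

end fin
end Heis27

theorem stmt_14 {G : Type*} [Group G] [Fintype G]
    (hcard : Fintype.card G = 27)
    (hexp : Monoid.exponent G = 3)
    (hna : ∃ a b : G, a * b ≠ b * a) :
    (∀ S : Multiset G, Multiset.card S = 7 → HasProdOneSubseq S) ∧
    smallDavenport G = 6 := by
  refine ⟨Heis27.main7 hcard hexp hna, ?_⟩
  refine IsGreatest.csSup_eq ⟨Heis27.free6 hcard hexp hna, ?_⟩
  rintro n ⟨S, rfl, hS⟩
  by_contra hn
  have hT : ((S.toList.take 7 : List G) : Multiset G) ≤ S := by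
    conv_rhs => rw [← S.coe_toList]
    exact Multiset.coe_le.mpr (List.take_sublist 7 S.toList).subperm
  have hc : Multiset.card ((S.toList.take 7 : List G) : Multiset G) = 7 := by
    simp; omega
  exact hS (Heis27.has_mono hT (Heis27.main7 hcard hexp hna _ hc))
end

section
/- Let $T$ be a sequence of length $28$ over the cyclic group $C_3$ of order $3$. Then either $T$ has a subsequence of length $27$ whose product is the identity, or $T$ has two subsequences $T'$ and $T''$, each of length $27$, whose products are the two distinct non-identity elements of $C_3$. -/
theorem aux_16 {G : Type*} [CommGroup G] [Fintype G]
    (hcard : Fintype.card G = 3)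
    (T : Multiset G) (hlen : Multiset.card T = 28) :
    (∃ l : List G, (l : Multiset G) ≤ T ∧ l.length = 27 ∧ l.prod = 1) ∨
    (∃ l₁ l₂ : List G, (l₁ : Multiset G) ≤ T ∧ (l₂ : Multiset G) ≤ T ∧
      l₁.length = 27 ∧ l₂.length = 27 ∧
      l₁.prod ≠ 1 ∧ l₂.prod ≠ 1 ∧ l₁.prod ≠ l₂.prod) := by
  classical
  induction T using Quotient.inductionOn with
  | _ L =>
  have hL : L.length = 28 := hlen
  have key : ∀ a ∈ L, ((L.erase a : List G) : Multiset G) ≤ (L : Multiset G) ∧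
      (L.erase a).length = 27 ∧ a * (L.erase a).prod = L.prod := by
    intro a ha
    refine ⟨Multiset.coe_le.2 (List.erase_sublist).subperm, ?_, List.prod_erase ha⟩
    rw [List.length_erase_of_mem ha, hL]
  by_cases h : ∃ a ∈ L, ∃ b ∈ L, a ≠ b
  · obtain ⟨a, ha, b, hb, hab⟩ := h
    obtain ⟨a1, a2, a3⟩ := key a ha
    obtain ⟨b1, b2, b3⟩ := key b hb
    by_cases h1 : (L.erase a).prod = 1
    · exact Or.inl ⟨_, a1, a2, h1⟩
    by_cases h2 : (L.erase b).prod = 1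
    · exact Or.inl ⟨_, b1, b2, h2⟩
    refine Or.inr ⟨_, _, a1, b1, a2, b2, h1, h2, fun h3 => hab ?_⟩
    rw [← b3, h3] at a3
    exact mul_right_cancel a3
  · push Not at h
    obtain ⟨a, ha⟩ := List.exists_mem_of_length_pos (by omega : 0 < L.length)
    obtain ⟨a1, a2, -⟩ := key a ha
    refine Or.inl ⟨_, a1, a2, ?_⟩
    have h3 : a ^ 3 = 1 := hcard ▸ pow_card_eq_one
    rw [List.prod_eq_pow_card _ a (fun x hx => h x (List.mem_of_mem_erase hx) a ha), a2,
      show 27 = 3 * 9 from rfl, pow_mul, h3, one_pow]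

theorem stmt_16 {G : Type*} [Group G] [IsCyclic G] [Fintype G]
    (hcard : Fintype.card G = 3)
    (T : Multiset G) (hlen : Multiset.card T = 28) :
    (∃ l : List G, (l : Multiset G) ≤ T ∧ l.length = 27 ∧ l.prod = 1) ∨
    (∃ l₁ l₂ : List G, (l₁ : Multiset G) ≤ T ∧ (l₂ : Multiset G) ≤ T ∧
      l₁.length = 27 ∧ l₂.length = 27 ∧
      l₁.prod ≠ 1 ∧ l₂.prod ≠ 1 ∧ l₁.prod ≠ l₂.prod) := by
  exact @aux_16 G IsCyclic.commGroup _ hcard T hlen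
end

section
/- Let $G$ be the non-abelian group of order $27$ and exponent $3$. Every sequence of length $33$ over $G$ contains a subsequence of length exactly $27$ whose terms, in some order, multiply to the identity. Consequently, the Gao constant satisfies $\mathsf{E}(G) = 33 = \mathsf{d}(G) + |G|$. -/
/-- The Gao constant: the least `N` such that every sequence over `G` of length
at least `N` has a product-one subsequence of length exactly `|G|`. -/
noncomputable def gaoConstant (G : Type*) [Group G] : ℕ :=
  sInf {N | ∀ S : Multiset G, N ≤ Multiset.card S →
    ∃ l : List G, (l : Multiset G) ≤ S ∧ l.length = Nat.card G ∧ l.prod = 1}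

instance fact3 : Fact (Nat.Prime 3) := ⟨by norm_num⟩

/-- Olson-type lemma from Chevalley–Warning. -/
lemma zs_finset {ι : Type*} [DecidableEq ι] (s : Finset ι) (k : ℕ) (f : Fin k → ι → ZMod 3)
    (hs : 2 * k < s.card) : ∃ t ⊆ s, t.Nonempty ∧ ∀ i, ∑ j ∈ t, f i j = 0 := by
  classical
  let F : Fin k → MvPolynomial s (ZMod 3) := fun i => ∑ j : s, f i j • MvPolynomial.X j ^ 2
  have hdeg : (∑ i, (F i).totalDegree) < Fintype.card s := by
    calc (∑ i, (F i).totalDegree) ≤ ∑ _i : Fin k, 2 := by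
          apply Finset.sum_le_sum
          intro i _
          apply MvPolynomial.totalDegree_finsetSum_le
          intro j _
          exact (MvPolynomial.totalDegree_smul_le ..).trans
            (MvPolynomial.totalDegree_X_pow ..).le
      _ < _ := by simp; omega
  have hdvd : 3 ∣ Nat.card { x : s → ZMod 3 // ∀ i, MvPolynomial.eval x (F i) = 0 } := by
    have h := char_dvd_card_solutions_of_fintype_sum_lt (K := ZMod 3) 3 hdeg
    rwa [Fintype.card_eq_nat_card] at h
  let z : { x : s → ZMod 3 // ∀ i, MvPolynomial.eval x (F i) = 0 } := ⟨0, by simp [F]⟩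
  have h0 : 0 < Fintype.card { x : s → ZMod 3 // ∀ i, MvPolynomial.eval x (F i) = 0 } :=
    @Fintype.card_pos _ _ ⟨z⟩
  obtain ⟨x, hx⟩ := Fintype.exists_ne_of_one_lt_card
    (show 1 < Fintype.card { x : s → ZMod 3 // ∀ i, MvPolynomial.eval x (F i) = 0 } by
      rw [← Nat.card_eq_fintype_card] at h0 ⊢
      exact lt_of_lt_of_le (by norm_num) (Nat.le_of_dvd h0 hdvd)) z
  refine ⟨({a | x.1 a ≠ 0} : Finset s).map ⟨(↑), Subtype.val_injective⟩, ?_, ?_, ?_⟩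
  · simp +contextual [Finset.subset_iff]
  · rw [← Subtype.coe_ne_coe, Function.ne_iff] at hx
    obtain ⟨a, ha⟩ := hx
    exact ⟨a, Finset.mem_map_of_mem _ (Finset.mem_filter.2 ⟨Finset.mem_univ _, ha⟩)⟩
  · intro i
    have h := x.2 i
    have h2 : ∀ u : ZMod 3, u ^ 2 = if u ≠ 0 then 1 else 0 := by decide
    simp only [F, map_sum, MvPolynomial.smul_eval, map_pow, MvPolynomial.eval_X, h2] at h
    rw [Finset.sum_map, Finset.sum_filter]
    simpa using h

lemma zs {α : Type*} (S : Multiset α) (k : ℕ) (f : Fin k → α → ZMod 3)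
    (hS : 2 * k < S.card) :
    ∃ T ≤ S, T ≠ 0 ∧ ∀ i, (T.map (f i)).sum = 0 := by
  classical
  obtain ⟨t, hts, hne, ht⟩ := zs_finset S.toEnumFinset k (fun i p => f i p.1) (by simpa using hS)
  refine ⟨t.1.map Prod.fst, Multiset.map_fst_le_of_subset_toEnumFinset hts, ?_, ?_⟩
  · simpa using hne.ne_empty
  · intro i
    simpa [Multiset.map_map] using ht i

lemma sub_card {α : Type*} (S : Multiset α) (n : ℕ) (h : n ≤ S.card) :
    ∃ T ≤ S, T.card = n := by
  obtain ⟨T, hT⟩ := Multiset.card_pos_iff_exists_mem.1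
    (show 0 < (S.powersetCard n).card by
      rw [Multiset.card_powersetCard]; exact Nat.choose_pos h)
  rw [Multiset.mem_powersetCard] at hT
  exact ⟨T, hT.1, hT.2⟩

lemma zs1 {α : Type*} (S : Multiset α) (f : α → ZMod 3) (hS : 3 ≤ S.card) :
    ∃ T ≤ S, T ≠ 0 ∧ T.card ≤ 3 ∧ (T.map f).sum = 0 := by
  obtain ⟨S', h1, h2⟩ := sub_card S 3 hS
  obtain ⟨T, hT, h0, h⟩ := zs S' 1 ![f] (by omega)
  have := Multiset.card_le_card hT
  exact ⟨T, hT.trans h1, h0, by omega, h 0⟩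

lemma zs2 {α : Type*} (S : Multiset α) (f g : α → ZMod 3) (hS : 5 ≤ S.card) :
    ∃ T ≤ S, T ≠ 0 ∧ T.card ≤ 5 ∧ (T.map f).sum = 0 ∧ (T.map g).sum = 0 := by
  obtain ⟨S', h1, h2⟩ := sub_card S 5 hS
  obtain ⟨T, hT, h0, h⟩ := zs S' 2 ![f, g] (by omega)
  have := Multiset.card_le_card hT
  exact ⟨T, hT.trans h1, h0, by omega, h 0, h 1⟩

lemma zs3 {α : Type*} (S : Multiset α) (f g e : α → ZMod 3) (hS : 7 ≤ S.card) :
    ∃ T ≤ S, T ≠ 0 ∧ T.card ≤ 7 ∧ (T.map f).sum = 0 ∧ (T.map g).sum = 0 ∧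
      (T.map e).sum = 0 := by
  obtain ⟨S', h1, h2⟩ := sub_card S 7 hS
  obtain ⟨T, hT, h0, h⟩ := zs S' 3 ![f, g, e] (by omega)
  have := Multiset.card_le_card hT
  exact ⟨T, hT.trans h1, h0, by omega, h 0, h 1, h 2⟩

lemma zs_le_sub {α : Type*} [DecidableEq α] {S T U : Multiset α} (hT : T ≤ S) (hU : U ≤ S - T) :
    T + U ≤ S := by
  calc T + U ≤ T + (S - T) := by gcongr
    _ = S := add_tsub_cancel_of_le hT

lemma zmod_card_dvd (n : ℕ) (h : (n : ZMod 3) = 0) : 3 ∣ n :=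
  (ZMod.natCast_eq_zero_iff n 3).1 h

/-- blocks of length 3 or 6 -/
lemma zs_block {α : Type*} (S : Multiset α) (f g : α → ZMod 3) (hS : 7 ≤ S.card) :
    ∃ T ≤ S, (T.card = 3 ∨ T.card = 6) ∧ (T.map f).sum = 0 ∧ (T.map g).sum = 0 := by
  obtain ⟨T, h1, h2, h3, h4, h5, h6⟩ := zs3 S f g (fun _ => 1) hS
  refine ⟨T, h1, ?_, h4, h5⟩
  have : 3 ∣ T.card := zmod_card_dvd _ (by simpa using h6)
  have : 0 < T.card := Multiset.card_pos.2 h2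
  omega

lemma zs_chain {α : Type*} (S : Multiset α) (f g : α → ZMod 3) (hS : 28 ≤ S.card) (j : ℕ)
    (hj : j ≤ 8) :
    ∃ T ≤ S, (T.card = 3 * j ∨ T.card = 3 * j + 3) ∧ (T.map f).sum = 0 ∧ (T.map g).sum = 0 := by
  classical
  induction j with
  | zero => exact ⟨0, by simp⟩
  | succ j ih =>
    obtain ⟨T, h1, h2, h3, h4⟩ := ih (by omega)
    rcases h2 with h2 | h2
    · obtain ⟨U, k1, k2, k3, k4⟩ := zs_block (S - T) f g (by
        rw [Multiset.card_sub h1]; omega)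
      refine ⟨T + U, zs_le_sub h1 k1, ?_, ?_, ?_⟩
      · rw [Multiset.card_add]; omega
      · rw [Multiset.map_add, Multiset.sum_add, h3, k3, add_zero]
      · rw [Multiset.map_add, Multiset.sum_add, h4, k4, add_zero]
    · exact ⟨T, h1, by omega, h3, h4⟩

lemma card_fiber {α β : Type*} [DecidableEq β] [Fintype β] (S : Multiset α) (f : α → β) :
    S.card = ∑ b, (S.filter (fun a => f a = b)).card := by
  classical
  induction S using Multiset.induction with
  | empty => simp
  | cons a S ih =>
    have : ∀ b, ((a ::ₘ S).filter (fun a => f a = b)).card =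
        (if f a = b then 1 else 0) + (S.filter (fun a => f a = b)).card := by
      intro b
      by_cases h : f a = b
      · simp [h, add_comm]
      · simp [h]
    simp only [this, Finset.sum_add_distrib, ← ih]
    simp [add_comm]

lemma zs_pigeon {α β : Type*} [DecidableEq β] [Fintype β] (S : Multiset α) (f : α → β) (n : ℕ)
    (h : Fintype.card β * n < S.card) : ∃ b, n < (S.filter (fun a => f a = b)).card := by
  by_contra! hc
  have h1 := card_fiber S f
  have h2 := Finset.sum_le_sum (fun b (_ : b ∈ Finset.univ) => hc b)
  simp at h2
  omega

lemma sum_const {α M : Type*} [AddCommMonoid M] (S : Multiset α) (f : α → M) (c : M)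
    (h : ∀ a ∈ S, f a = c) : (S.map f).sum = S.card • c := by
  rw [Multiset.map_congr rfl h]; simp

lemma zs_31 {α : Type*} (S : Multiset α) (f g : α → ZMod 3) (hS : 31 ≤ S.card) :
    ∃ T ≤ S, T.card = 27 ∧ (T.map f).sum = 0 ∧ (T.map g).sum = 0 := by
  classical
  obtain ⟨b, hb⟩ := zs_pigeon S (fun a => (f a, g a)) 2 (by simp; omega)
  obtain ⟨U, hU, hUc⟩ := sub_card _ 3 hb
  have hUS : U ≤ S := hU.trans (Multiset.filter_le _ _)
  have hv : ∀ a ∈ U, (f a, g a) = b := fun a ha =>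
    (Multiset.mem_filter.1 (Multiset.mem_of_le hU ha)).2
  have h3 : ∀ c : ZMod 3, (3:ℕ) • c = 0 := by decide
  have hf : (U.map f).sum = 0 := by
    rw [sum_const U f b.1 (fun a ha => by rw [← hv a ha]), hUc, h3]
  have hg : (U.map g).sum = 0 := by
    rw [sum_const U g b.2 (fun a ha => by rw [← hv a ha]), hUc, h3]
  obtain ⟨T, h1, h2, h4, h5⟩ := zs_chain (S - U) f g (by rw [Multiset.card_sub hUS]; omega) 8
    le_rfl
  rcases h2 with h2 | h2
  · refine ⟨U + T, zs_le_sub hUS h1, ?_, ?_, ?_⟩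
    · rw [Multiset.card_add]; omega
    · rw [Multiset.map_add, Multiset.sum_add, hf, h4, add_zero]
    · rw [Multiset.map_add, Multiset.sum_add, hg, h5, add_zero]
  · exact ⟨T, h1.trans (Multiset.sub_le_self _ _), h2, h4, h5⟩

lemma zs_29 {α : Type*} (S : Multiset α) (f : α → ZMod 3) (j : ℕ) (hS : 3 * j + 2 ≤ S.card) :
    ∃ T ≤ S, T.card = 3 * j ∧ (T.map f).sum = 0 := by
  classical
  induction j with
  | zero => exact ⟨0, by simp⟩
  | succ j ih =>
    obtain ⟨T, h1, h2, h3⟩ := ih (by omega)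
    obtain ⟨U, k1, k2, k3, k4, k5⟩ := zs2 (S - T) f (fun _ => 1) (by
        rw [Multiset.card_sub h1]; omega)
    have : 3 ∣ U.card := zmod_card_dvd _ (by simpa using k5)
    have : 0 < U.card := Multiset.card_pos.2 k2
    refine ⟨T + U, zs_le_sub h1 k1, ?_, ?_⟩
    · rw [Multiset.card_add]; omega
    · rw [Multiset.map_add, Multiset.sum_add, h3, k4, add_zero]

/-- Symmetric Heisenberg coordinates. -/
structure Coords (G : Type*) [Group G] where
  x : G → ZMod 3
  y : G → ZMod 3
  z : G → ZMod 3
  x_mul : ∀ g h, x (g * h) = x g + x h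
  y_mul : ∀ g h, y (g * h) = y g + y h
  z_mul : ∀ g h, z (g * h) = z g + z h - (x g * y h - x h * y g)
  inj : ∀ g, x g = 0 → y g = 0 → z g = 0 → g = 1

namespace Coords

variable {G : Type*} [Group G] (C : Coords G)

/-- the commutator form -/
def om (g h : G) : ZMod 3 := C.x g * C.y h - C.x h * C.y g

/-- noncentral elements -/
def nc (g : G) : Prop := ¬ (C.x g = 0 ∧ C.y g = 0)

/-- the multiset can be ordered to have product one -/
def _root_.P1 {G : Type*} [Group G] (T : Multiset G) : Prop :=
  ∃ l : List G, (l : Multiset G) = T ∧ l.prod = 1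

lemma x_one : C.x 1 = 0 := by
  have := C.x_mul 1 1
  simpa using this

lemma y_one : C.y 1 = 0 := by
  have := C.y_mul 1 1
  simpa using this

lemma z_one : C.z 1 = 0 := by
  have := C.z_mul 1 1
  simpa [C.x_one] using this

lemma x_prod (l : List G) : C.x l.prod = (l.map C.x).sum := by
  induction l with
  | nil => simp [C.x_one]
  | cons a l ih => simp [C.x_mul, ih]

lemma y_prod (l : List G) : C.y l.prod = (l.map C.y).sum := by
  induction l with
  | nil => simp [C.y_one]
  | cons a l ih => simp [C.y_mul, ih]

lemma x_of_coe {l : List G} {T : Multiset G} (h : (l : Multiset G) = T) :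
    C.x l.prod = (T.map C.x).sum := by
  subst h; simp [C.x_prod]

lemma y_of_coe {l : List G} {T : Multiset G} (h : (l : Multiset G) = T) :
    C.y l.prod = (T.map C.y).sum := by
  subst h; simp [C.y_prod]

lemma om_sum (a : G) (T : Multiset G) :
    (T.map (C.om a)).sum = C.x a * (T.map C.y).sum - (T.map C.x).sum * C.y a := by
  induction T using Multiset.induction with
  | empty => simp
  | cons b T ih => simp only [Multiset.map_cons, Multiset.sum_cons, ih, om]; ring

lemma z_comm_prod (l : List G) (h : ∀ a ∈ l, ∀ b ∈ l, C.om a b = 0) :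
    C.z l.prod = (l.map C.z).sum := by
  induction l with
  | nil => simp [C.z_one]
  | cons a l ih =>
    have h1 := ih (fun b hb c hc => h b (by simp [hb]) c (by simp [hc]))
    have h2 : ((l : Multiset G).map (C.om a)).sum = 0 := by
      apply Multiset.sum_eq_zero
      intro u hu
      obtain ⟨b, hb, rfl⟩ := Multiset.mem_map.1 hu
      exact h a (by simp) b (by simp at hb; simp [hb])
    rw [C.om_sum, ← C.x_of_coe rfl, ← C.y_of_coe rfl] at h2
    rw [List.prod_cons, C.z_mul, h1, h2]
    simp

lemma P1_comm (T : Multiset G) (hx : (T.map C.x).sum = 0) (hy : (T.map C.y).sum = 0)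
    (hz : (T.map C.z).sum = 0) (h : ∀ a ∈ T, ∀ b ∈ T, C.om a b = 0) : P1 T := by
  induction T using Quotient.inductionOn with
  | h l =>
    refine ⟨l, rfl, C.inj _ ?_ ?_ ?_⟩
    · rw [C.x_of_coe rfl]; exact hx
    · rw [C.y_of_coe rfl]; exact hy
    · rw [C.z_comm_prod l h]; simpa using hz

lemma z_swap (a b g : G) : C.z (b * (a * g)) = C.z (a * (b * g)) + 2 * C.om a b := by
  simp only [C.z_mul, C.x_mul, C.y_mul, om]; ring

lemma z_swap' (a b c d g : G) :
    C.z (a * (b * (d * (c * g)))) = C.z (a * (b * (c * (d * g)))) + 2 * C.om c d := by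
  simp only [C.z_mul, C.x_mul, C.y_mul, om]; ring

lemma P1_of_z {l : List G} {T : Multiset G} (hl : (l : Multiset G) = T)
    (hx : (T.map C.x).sum = 0) (hy : (T.map C.y).sum = 0) (hz : C.z l.prod = 0) : P1 T :=
  ⟨l, hl, C.inj _ (by rw [C.x_of_coe hl, hx]) (by rw [C.y_of_coe hl, hy]) hz⟩

lemma P1_two (a b c d : G) (R : Multiset G) (T : Multiset G)
    (hT : T = a ::ₘ b ::ₘ c ::ₘ d ::ₘ R)
    (hx : (T.map C.x).sum = 0) (hy : (T.map C.y).sum = 0)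
    (h1 : C.om a b ≠ 0) (h2 : C.om c d ≠ 0) : P1 T := by
  induction R using Quotient.inductionOn with
  | h r =>
  have key : ∀ s u v : ZMod 3, u ≠ 0 → v ≠ 0 →
      s = 0 ∨ s + 2 * u = 0 ∨ s + 2 * v = 0 ∨ s + 2 * v + 2 * u = 0 := by decide
  have e1 : ((a :: b :: c :: d :: r : List G) : Multiset G) = T := by rw [hT]; rfl
  have p1 : (b :: a :: c :: d :: r).Perm (a :: b :: c :: d :: r) := List.Perm.swap _ _ _
  have p2 : (a :: b :: d :: c :: r).Perm (a :: b :: c :: d :: r) :=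
    ((List.Perm.swap _ _ _).cons _).cons _
  have p3 : (b :: a :: d :: c :: r).Perm (a :: b :: d :: c :: r) := List.Perm.swap _ _ _
  have e2 : ((b :: a :: c :: d :: r : List G) : Multiset G) = T := by
    rw [← e1]; exact Multiset.coe_eq_coe.2 p1
  have e3 : ((a :: b :: d :: c :: r : List G) : Multiset G) = T := by
    rw [← e1]; exact Multiset.coe_eq_coe.2 p2
  have e4 : ((b :: a :: d :: c :: r : List G) : Multiset G) = T := by
    rw [← e1]; exact Multiset.coe_eq_coe.2 (p3.trans p2)
  rcases key (C.z (a * (b * (c * (d * r.prod))))) _ _ h1 h2 with h | h | h | h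
  · exact C.P1_of_z e1 hx hy (by simpa using h)
  · exact C.P1_of_z e2 hx hy (by simp only [List.prod_cons]; rw [C.z_swap, h])
  · exact C.P1_of_z e3 hx hy (by simp only [List.prod_cons]; rw [C.z_swap', h])
  · exact C.P1_of_z e4 hx hy (by simp only [List.prod_cons]; rw [C.z_swap, C.z_swap', h])

lemma om_self (a : G) : C.om a a = 0 := by simp [om]

lemma om_symm (a b : G) : C.om b a = - C.om a b := by simp only [om]; ring

lemma split_pair {T : Multiset G} {a b : G} (ha : a ∈ T) (hb : b ∈ T) (h : C.om a b ≠ 0) :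
    ∃ R, T = a ::ₘ b ::ₘ R := by
  obtain ⟨R, rfl⟩ := Multiset.exists_cons_of_mem ha
  rw [Multiset.mem_cons] at hb
  rcases hb with rfl | hb
  · exact absurd (C.om_self _) h
  · obtain ⟨R', rfl⟩ := Multiset.exists_cons_of_mem hb
    exact ⟨R', rfl⟩

lemma om_trans {a b c : G} (hc : C.nc c) (h1 : C.om c a = 0) (h2 : C.om c b = 0) :
    C.om a b = 0 := by
  have key : ∀ xa ya xb yb xc yc : ZMod 3, ¬ (xc = 0 ∧ yc = 0) → xc * ya - xa * yc = 0 →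
    xc * yb - xb * yc = 0 → xa * yb - xb * ya = 0 := by decide
  exact key _ _ _ _ _ _ hc h1 h2

lemma nc_of_om_left {a b : G} (h : C.om a b ≠ 0) : C.nc a := by
  intro h'; apply h; simp [om, h'.1, h'.2]

lemma nc_of_om_right {a b : G} (h : C.om a b ≠ 0) : C.nc b := by
  intro h'; apply h; simp [om, h'.1, h'.2]

open Classical in
lemma good (T : Multiset G) (hx : (T.map C.x).sum = 0) (hy : (T.map C.y).sum = 0)
    {a b : G} (ha : a ∈ T) (hb : b ∈ T) (hab : C.om a b ≠ 0)
    (h4 : 4 ≤ (T.filter C.nc).card) : P1 T := by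
  obtain ⟨R, hR⟩ := C.split_pair ha hb hab
  have h2 : 2 ≤ (R.filter C.nc).card := by
    rw [hR, Multiset.filter_cons, Multiset.filter_cons, Multiset.card_add, Multiset.card_add] at h4
    split_ifs at h4 <;> simp at h4 <;> omega
  obtain ⟨D, hD, hDc⟩ := sub_card _ 2 h2
  obtain ⟨c, d, rfl⟩ := Multiset.card_eq_two.1 hDc
  have hc : C.nc c := (Multiset.mem_filter.1 (Multiset.mem_of_le hD (by simp))).2
  have hd : C.nc d := (Multiset.mem_filter.1 (Multiset.mem_of_le hD (by simp))).2
  obtain ⟨Q, rfl⟩ := Multiset.le_iff_exists_add.1 (hD.trans (Multiset.filter_le _ _))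
  have hT : T = a ::ₘ b ::ₘ c ::ₘ d ::ₘ Q := by rw [hR]; simp
  by_cases hcd : C.om c d = 0
  · by_cases he : ∃ e ∈ Q, C.om c e ≠ 0
    · obtain ⟨e, he, hce⟩ := he
      obtain ⟨Q', rfl⟩ := Multiset.exists_cons_of_mem he
      exact C.P1_two a b c e (d ::ₘ Q') T (by rw [hT, Multiset.cons_swap d e]) hx hy hab hce
    · push Not at he
      have hs := C.om_sum c T
      rw [hx, hy, hT] at hs
      have hQ : (Q.map (C.om c)).sum = 0 := by
        apply Multiset.sum_eq_zero
        intro u hu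
        obtain ⟨b, hb, rfl⟩ := Multiset.mem_map.1 hu
        exact he b hb
      simp only [Multiset.map_cons, Multiset.sum_cons, hQ, hcd, C.om_self, add_zero, mul_zero,
        zero_mul, sub_zero] at hs
      have hca : C.om c a ≠ 0 := by
        intro h
        rw [h, zero_add] at hs
        exact hab (C.om_trans hc h hs)
      have hcb : C.om c b ≠ 0 := by
        intro h
        rw [h, add_zero] at hs
        exact hca hs
      have hdb : C.om d b ≠ 0 := by
        intro h
        exact hcb (C.om_trans hd (by rw [C.om_symm, hcd, neg_zero]) h)
      refine C.P1_two c a d b Q T ?_ hx hy hca hdb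
      rw [hT, Multiset.cons_swap b c, Multiset.cons_swap a c, Multiset.cons_swap b d]
  · exact C.P1_two a b c d Q T hT hx hy hab hcd

lemma P1_w (T : Multiset G) (hx : (T.map C.x).sum = 0) (hy : (T.map C.y).sum = 0)
    {a b w : G} (ha : a ∈ T) (hb : b ∈ T) (hab : C.om a b ≠ 0)
    (hwx : C.x w = 0) (hwy : C.y w = 0) (hwz : C.z w ≠ 0) : P1 T ∨ P1 (w ::ₘ T) := by
  obtain ⟨R, rfl⟩ := C.split_pair ha hb hab
  induction R using Quotient.inductionOn with
  | h r =>
  have key : ∀ s u v : ZMod 3, u ≠ 0 → v ≠ 0 →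
      s = 0 ∨ s + 2 * u = 0 ∨ v + s = 0 ∨ v + (s + 2 * u) = 0 := by decide
  have p1 : (b :: a :: r).Perm (a :: b :: r) := List.Perm.swap _ _ _
  have hw : ∀ g, C.z (w * g) = C.z w + C.z g := by
    intro g; rw [C.z_mul, hwx, hwy]; ring
  rcases key (C.z (a * (b * r.prod))) _ _ hab hwz with h | h | h | h
  · exact Or.inl (C.P1_of_z (l := a :: b :: r) rfl hx hy (by simpa using h))
  · exact Or.inl (C.P1_of_z (l := b :: a :: r) (Multiset.coe_eq_coe.2 p1) hx hy
      (by simp only [List.prod_cons]; rw [C.z_swap, h]))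
  · refine Or.inr (C.P1_of_z (l := w :: a :: b :: r) rfl ?_ ?_ ?_)
    · rw [Multiset.map_cons, Multiset.sum_cons, hwx, hx, add_zero]
    · rw [Multiset.map_cons, Multiset.sum_cons, hwy, hy, add_zero]
    · simp only [List.prod_cons]; rw [hw, h]
  · refine Or.inr (C.P1_of_z (l := w :: b :: a :: r) (Multiset.coe_eq_coe.2 (p1.cons _)) ?_ ?_ ?_)
    · rw [Multiset.map_cons, Multiset.sum_cons, hwx, hx, add_zero]
    · rw [Multiset.map_cons, Multiset.sum_cons, hwy, hy, add_zero]
    · simp only [List.prod_cons]; rw [hw, C.z_swap, h]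

/-- Nonempty product-one sub-multiset -/
def _root_.Q1 {G : Type*} [Group G] (S : Multiset G) : Prop := ∃ T ≤ S, T ≠ 0 ∧ P1 T

open Classical in
/-- The small Davenport constant is at most 6. -/
lemma dav (C : Coords G) (S : Multiset G) (hS : 7 ≤ S.card) : Q1 S := by
  obtain ⟨T, hTS, hT0, hTc, hx, hy, hz⟩ := zs3 S C.x C.y C.z hS
  by_cases hcomm : ∀ a ∈ T, ∀ b ∈ T, C.om a b = 0
  · exact ⟨T, hTS, hT0, C.P1_comm T hx hy hz hcomm⟩
  push Not at hcomm
  obtain ⟨a, ha, b, hb, hab⟩ := hcomm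
  by_cases h4 : 4 ≤ (T.filter C.nc).card
  · exact ⟨T, hTS, hT0, C.good T hx hy ha hb hab h4⟩
  by_cases hw : ∃ w ∈ S, C.x w = 0 ∧ C.y w = 0
  · obtain ⟨w, hwS, hwx, hwy⟩ := hw
    by_cases hwz : C.z w = 0
    · refine ⟨{w}, by simpa using hwS, by simp, [w], rfl, ?_⟩
      simpa using C.inj w hwx hwy hwz
    have haw : a ≠ w := by
      rintro rfl; exact C.nc_of_om_left hab ⟨hwx, hwy⟩
    have hbw : b ≠ w := by
      rintro rfl; exact C.nc_of_om_right hab ⟨hwx, hwy⟩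
    have : ∃ T0, a ∈ T0 ∧ b ∈ T0 ∧ w ::ₘ T0 ≤ S ∧ (T0.map C.x).sum = 0 ∧
        (T0.map C.y).sum = 0 := by
      by_cases hwT : w ∈ T
      · obtain ⟨T0, rfl⟩ := Multiset.exists_cons_of_mem hwT
        refine ⟨T0, ?_, ?_, hTS, ?_, ?_⟩
        · simpa [haw] using ha
        · simpa [hbw] using hb
        · simpa [hwx] using hx
        · simpa [hwy] using hy
      · refine ⟨T, ha, hb, ?_, hx, hy⟩
        obtain ⟨S', rfl⟩ := Multiset.exists_cons_of_mem hwS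
        exact Multiset.cons_le_cons _ ((Multiset.le_cons_of_notMem hwT).1 hTS)
    obtain ⟨T0, ha, hb, hle, hx, hy⟩ := this
    rcases C.P1_w T0 hx hy ha hb hab hwx hwy hwz with h | h
    · refine ⟨T0, (Multiset.le_cons_self _ _).trans hle, ?_, h⟩
      rintro rfl; simp at ha
    · exact ⟨_, hle, by simp, h⟩
  · have hnc : ∀ g ∈ S, C.nc g := fun g hg h => hw ⟨g, hg, h⟩
    have hfil : ∀ U ≤ S, U.filter C.nc = U := fun U hU =>
      Multiset.filter_eq_self.2 fun g hg => hnc g (Multiset.mem_of_le hU hg)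
    rw [hfil T hTS] at h4
    by_contra hQ
    have hD4 : 4 ≤ (S - T).card := by rw [Multiset.card_sub hTS]; omega
    obtain ⟨R, hR⟩ := C.split_pair ha hb hab
    have hRc : R.card ≤ 1 := by rw [hR] at h4; simp at h4; omega
    have hR0 : R ≠ 0 := by
      rintro rfl
      rw [hR] at hx hy
      simp at hx hy
      apply hab
      rw [om, eq_neg_of_add_eq_zero_left hx, eq_neg_of_add_eq_zero_left hy]; ring
    obtain ⟨c, rfl⟩ := Multiset.card_eq_one.1
      (show R.card = 1 by have := Multiset.card_pos.2 hR0; omega)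
    have hTc3 : T.card = 3 := by rw [hR]; rfl
    have hx' : C.x a + (C.x b + C.x c) = 0 := by rw [hR] at hx; simpa using hx
    have hy' : C.y a + (C.y b + C.y c) = 0 := by rw [hR] at hy; simpa using hy
    have noD : ∀ D' ≤ S - T, D' ≠ 0 → (D'.map C.x).sum = 0 → (D'.map C.y).sum = 0 → False := by
      intro D' h1 h2 h3 h4
      have hle := zs_le_sub hTS h1
      refine hQ ⟨T + D', hle, ?_, C.good _ ?_ ?_ (a := a) (b := b) (by simp [ha]) (by simp [hb])
        hab ?_⟩
      · simp [hT0]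
      · simp [hx, h3]
      · simp [hy, h4]
      · rw [hfil _ hle, Multiset.card_add]
        have := Multiset.card_pos.2 h2
        omega
    have ext : ∀ u v e : G, T = u ::ₘ v ::ₘ {e} → C.om u v ≠ 0 →
        ∃ d ∈ S - T, C.x d = -(C.x u + C.x v) ∧ C.y d = -(C.y u + C.y v) := by
      intro u v e hT huv
      obtain ⟨Q, hQS, hQ0, hQc, hQx, hQy⟩ := zs2 ((u * v) ::ₘ (S - T)) C.x C.y
        (by rw [Multiset.card_cons]; omega)
      by_cases hm : u * v ∈ Q
      · obtain ⟨D', rfl⟩ := Multiset.exists_cons_of_mem hm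
        have hD' : D' ≤ S - T := (Multiset.cons_le_cons_iff _).1 hQS
        simp only [Multiset.map_cons, Multiset.sum_cons, C.x_mul, C.y_mul] at hQx hQy
        have hle : u ::ₘ v ::ₘ D' ≤ S := by
          refine le_trans ?_ (zs_le_sub hTS hD')
          rw [hT]
          simp only [Multiset.cons_add, Multiset.singleton_add]
          exact Multiset.cons_le_cons _ (Multiset.cons_le_cons _ (Multiset.le_cons_self _ _))
        by_cases h2 : 2 ≤ D'.card
        · exfalso
          refine hQ ⟨_, hle, by simp, C.good _ ?_ ?_ (a := u) (b := v) (by simp) (by simp) huv ?_⟩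
          · simpa [add_assoc] using hQx
          · simpa [add_assoc] using hQy
          · rw [hfil _ hle]; simp; omega
        · have h0 : D' ≠ 0 := by
            rintro rfl
            simp at hQx hQy
            apply huv
            rw [om, eq_neg_of_add_eq_zero_left hQx, eq_neg_of_add_eq_zero_left hQy]; ring
          obtain ⟨d, rfl⟩ := Multiset.card_eq_one.1
            (show D'.card = 1 by have := Multiset.card_pos.2 h0; omega)
          refine ⟨d, by simpa using hD', ?_, ?_⟩
          · simp only [Multiset.map_singleton, Multiset.sum_singleton] at hQx
            exact eq_neg_of_add_eq_zero_right hQx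
          · simp only [Multiset.map_singleton, Multiset.sum_singleton] at hQy
            exact eq_neg_of_add_eq_zero_right hQy
      · exact (noD Q ((Multiset.le_cons_of_notMem hm).1 hQS) hQ0 hQx hQy).elim
    have hxc : C.x c = -(C.x a + C.x b) := by linear_combination hx'
    have hyc : C.y c = -(C.y a + C.y b) := by linear_combination hy'
    have hbc : C.om b c = C.om a b := by rw [om, om, hxc, hyc]; ring
    have hca : C.om c a = C.om a b := by rw [om, om, hxc, hyc]; ring
    obtain ⟨d1, m1, x1, y1⟩ := ext a b c hR hab
    obtain ⟨d2, m2, x2, y2⟩ := ext b c a (by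
      rw [hR]; simp only [← Multiset.singleton_add]; abel) (by rwa [hbc])
    obtain ⟨d3, m3, x3, y3⟩ := ext c a b (by
      rw [hR]; simp only [← Multiset.singleton_add]; abel) (by rwa [hca])
    have o12 : C.om d2 d3 = C.om a b := by
      rw [om, om, x2, x3, y2, y3, hxc, hyc]; ring
    have o23 : C.om d3 d1 = C.om a b := by
      rw [om, om, x1, x3, y1, y3, hxc, hyc]; ring
    have o31 : C.om d1 d2 = C.om a b := by
      rw [om, om, x1, x2, y1, y2, hxc, hyc]; ring
    have ne : ∀ g h, C.om g h = C.om a b → g ≠ h := by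
      rintro g h e rfl
      rw [C.om_self] at e
      exact hab e.symm
    refine noD {d1, d2, d3} ?_ (by simp) ?_ ?_
    · rw [Multiset.le_iff_subset]
      · intro g hg
        simp at hg
        rcases hg with rfl | rfl | rfl <;> assumption
      · have n1 := ne _ _ o12
        have n2 := (ne _ _ o23).symm
        have n3 := ne _ _ o31
        simp [n1, n2, n3]
    · simp [x1, x2, x3, hxc]
    · simp [y1, y2, y3, hyc]

/-- product-one sub-multiset of size 27 -/
def _root_.R27 {G : Type*} [Group G] (S : Multiset G) : Prop := ∃ T ≤ S, T.card = 27 ∧ P1 T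

lemma _root_.P1_add {G : Type*} [Group G] {T U : Multiset G} (hT : P1 T) (hU : P1 U) :
    P1 (T + U) := by
  obtain ⟨l, rfl, hl⟩ := hT
  obtain ⟨m, rfl, hm⟩ := hU
  exact ⟨l ++ m, rfl, by simp [hl, hm]⟩

open Classical in
lemma greedy (C : Coords G) (n : ℕ) (R : Multiset G) (hn : R.card ≤ n) :
    ∃ T ≤ R, R.card ≤ T.card + 6 ∧ P1 T := by
  induction n generalizing R with
  | zero => exact ⟨0, by simp, by omega, [], rfl, rfl⟩
  | succ n ih =>
    by_cases h : R.card ≤ 6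
    · exact ⟨0, by simp, by omega, [], rfl, rfl⟩
    obtain ⟨U, hU, hU0, hUP⟩ := C.dav R (by omega)
    have := Multiset.card_pos.2 hU0
    have hc := Multiset.card_sub hU
    have hUR := Multiset.card_le_card hU
    obtain ⟨T, hT, hTc, hTP⟩ := ih (R - U) (by omega)
    exact ⟨U + T, zs_le_sub hU hT, by rw [Multiset.card_add]; omega, P1_add hUP hTP⟩

lemma inj2 (C : Coords G) {g h : G} (hx : C.x g = C.x h) (hy : C.y g = C.y h)
    (hz : C.z g = C.z h) : g = h := by
  have ex := C.x_mul (g * h⁻¹) h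
  have ey := C.y_mul (g * h⁻¹) h
  have ez := C.z_mul (g * h⁻¹) h
  rw [inv_mul_cancel_right] at ex ey ez
  have ex' : C.x (g * h⁻¹) = 0 := by rw [hx] at ex; simpa using ex
  have ey' : C.y (g * h⁻¹) = 0 := by rw [hy] at ey; simpa using ey
  rw [ex', ey', hz] at ez
  have ez' : C.z (g * h⁻¹) = 0 := by simpa using ez
  exact mul_inv_eq_one.1 (C.inj _ ex' ey' ez')

lemma central (C : Coords G) {w : G} (hx : C.x w = 0) (hy : C.y w = 0) (g : G) :
    w * g = g * w := by
  apply C.inj2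
  · rw [C.x_mul, C.x_mul, add_comm]
  · rw [C.y_mul, C.y_mul, add_comm]
  · rw [C.z_mul, C.z_mul, hx, hy]; ring

lemma cube (C : Coords G) (w : G) : w ^ 3 = 1 := by
  have h3 : ∀ a : ZMod 3, a + a + a = 0 := by decide
  rw [pow_succ, pow_two]
  apply C.inj
  · rw [C.x_mul, C.x_mul, h3]
  · rw [C.y_mul, C.y_mul, h3]
  · simp only [C.z_mul, C.x_mul, C.y_mul]
    linear_combination h3 (C.z w)

lemma prod_shift {w : G} (hw : ∀ g, w * g = g * w) (l : List G) :
    (l.map (· * w)).prod = l.prod * w ^ l.length := by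
  induction l with
  | nil => simp
  | cons a l ih =>
    rw [List.map_cons, List.prod_cons, ih, List.prod_cons, List.length_cons, pow_succ']
    calc a * w * (l.prod * w ^ l.length) = a * (w * l.prod) * w ^ l.length := by
          simp only [mul_assoc]
      _ = _ := by rw [hw]; simp only [mul_assoc]

open Classical in
lemma cent6 (C : Coords G) (S : Multiset G) (hS : S.card = 33) (w : G) (hx : C.x w = 0)
    (hy : C.y w = 0) (hc : 6 ≤ S.count w) : R27 S := by
  have hsplit := Multiset.filter_add_not (fun g => g = w) S
  have h1 : S.filter (fun g => g = w) = Multiset.replicate (S.count w) w :=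
    Multiset.filter_eq' S w
  rw [h1] at hsplit
  set R := S.filter (fun g => ¬ g = w) with hR
  have hcard : S.count w + R.card = 33 := by
    rw [← hS, ← hsplit, Multiset.card_add, Multiset.card_replicate, hsplit]
  obtain ⟨T, hT, hTc, l, rfl, hl⟩ := C.greedy _ (R.map (· * w⁻¹)) le_rfl
  have hle := Multiset.card_le_card hT
  rw [Multiset.card_map] at hTc hle
  rw [Multiset.coe_card] at hTc hle
  refine ⟨Multiset.replicate (27 - l.length) w + (l : Multiset G).map (· * w), ?_, ?_, ?_⟩
  · rw [← hsplit]
    refine add_le_add ?_ ?_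
    · rw [Multiset.replicate_le_replicate]
      omega
    · refine (Multiset.map_le_map hT).trans ?_
      rw [Multiset.map_map]
      simp
  · simp; omega
  · refine ⟨List.replicate (27 - l.length) w ++ l.map (· * w), ?_, ?_⟩
    · simp [← Multiset.coe_add, Multiset.coe_replicate]
    · rw [List.prod_append, prod_shift (C.central hx hy), hl, List.prod_replicate, one_mul,
        ← pow_add, Nat.sub_add_cancel (by omega), show 27 = 3 * 9 from rfl, pow_mul, C.cube,
        one_pow]

open Classical in
lemma key15 (C : Coords G) (S : Multiset G) (hS : S.card = 33) :
    R27 S ∨ (S.filter (fun g => ¬ C.nc g)).card ≤ 15 := by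
  by_contra! h
  obtain ⟨h1, h2⟩ := h
  obtain ⟨b, hb⟩ := zs_pigeon (S.filter (fun g => ¬ C.nc g)) C.z 5 (by simp; omega)
  obtain ⟨w, hw⟩ := Multiset.card_pos_iff_exists_mem.1 (lt_of_le_of_lt (Nat.zero_le _) hb)
  simp only [Multiset.mem_filter, nc, not_not] at hw
  apply h1
  refine C.cent6 S hS w hw.1.2.1 hw.1.2.2 ?_
  rw [← Multiset.countP_eq_card_filter, Multiset.countP_filter] at hb
  refine lt_of_lt_of_le hb ?_
  rw [Multiset.count, Multiset.countP_eq_card_filter, Multiset.countP_eq_card_filter]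
  apply Multiset.card_le_card
  apply Multiset.monotone_filter_right
  intro g hg
  simp only [nc, not_not] at hg
  exact C.inj2 (by rw [hg.2.1, hw.1.2.1]) (by rw [hg.2.2, hw.1.2.2]) (by rw [hg.1, hw.2])

lemma _root_.sum_zero_of {G : Type*} {T : Multiset G} {f : G → ZMod 3} (h : ∀ t ∈ T, f t = 0) :
    (T.map f).sum = 0 := by
  apply Multiset.sum_eq_zero
  intro u hu
  obtain ⟨b, hb, rfl⟩ := Multiset.mem_map.1 hu
  exact h b hb

lemma om_x0 (C : Coords G) {a b : G} (ha : C.x a = 0) (hb : C.x b = 0) : C.om a b = 0 := by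
  simp [om, ha, hb]

open Classical in
lemma line31 (C : Coords G) (S : Multiset G) (h : 31 ≤ (S.filter (fun g => C.x g = 0)).card) :
    R27 S := by
  obtain ⟨T, hT, hc, hy, hz⟩ := zs_31 _ C.y C.z h
  have h0 : ∀ t ∈ T, C.x t = 0 := fun t ht =>
    (Multiset.mem_filter.1 (Multiset.mem_of_le hT ht)).2
  exact ⟨T, hT.trans (Multiset.filter_le _ _), hc, C.P1_comm T (sum_zero_of h0) hy hz
    (fun a ha b hb => C.om_x0 (h0 a ha) (h0 b hb))⟩

open Classical in
lemma nc12 (C : Coords G) {S T : Multiset G} (hT : T ≤ S) (hc : T.card = 27)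
    (h15 : (S.filter (fun g => ¬ C.nc g)).card ≤ 15) : 12 ≤ (T.filter C.nc).card := by
  have h1 := congrArg Multiset.card (Multiset.filter_add_not C.nc T)
  rw [Multiset.card_add] at h1
  have h2 := Multiset.card_le_card (Multiset.filter_le_filter (fun g => ¬ C.nc g) hT)
  omega

open Classical in
lemma caseB (C : Coords G) (S : Multiset G) (hS : S.card = 33)
    (h27 : 27 ≤ (S.filter (fun g => C.x g = 0)).card) : R27 S := by
  rcases C.key15 S hS with h | h15
  · exact h
  by_cases h31 : 31 ≤ (S.filter (fun g => C.x g = 0)).card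
  · exact C.line31 S h31
  have hAO := Multiset.filter_add_not (fun g => C.x g = 0) S
  have hAx : ∀ g ∈ S.filter (fun g => C.x g = 0), C.x g = 0 := fun g hg =>
    (Multiset.mem_filter.1 hg).2
  have hOx : ∀ g ∈ S.filter (fun g => ¬ C.x g = 0), C.x g ≠ 0 := fun g hg =>
    (Multiset.mem_filter.1 hg).2
  have fin : ∀ T ≤ S, T.card = 27 → (T.map C.x).sum = 0 → (T.map C.y).sum = 0 →
      ∀ o ∈ T, C.x o ≠ 0 → R27 S := by
    intro T hT hTc hx hy o ho hox
    have : ∃ e ∈ T, C.x e = 0 ∧ C.y e ≠ 0 := by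
      by_contra! hcon
      have h1 := congrArg Multiset.card (Multiset.filter_add_not (fun g => C.x g = 0) T)
      have h2 := Multiset.card_le_card (Multiset.filter_le_filter (fun g => ¬ C.x g = 0) hT)
      have h3 := Multiset.card_le_card (Multiset.filter_le_filter (fun g => ¬ C.nc g) hT)
      have h4 : T.filter (fun g => C.x g = 0) ≤ T.filter (fun g => ¬ C.nc g) := by
        rw [Multiset.le_filter]
        refine ⟨Multiset.filter_le _ _, fun g hg => ?_⟩
        rw [Multiset.mem_filter] at hg
        simp only [nc, not_not]
        exact ⟨hg.2, hcon g hg.1 hg.2⟩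
      have h5 := Multiset.card_le_card h4
      have h6 := congrArg Multiset.card hAO
      rw [Multiset.card_add] at h1 h6
      omega
    obtain ⟨e, he, hex, hey⟩ := this
    refine ⟨T, hT, hTc, C.good T hx hy ho he ?_ ?_⟩
    · simp [om, hex, hox, hey]
    · have := C.nc12 hT hTc h15
      omega
  set A := S.filter (fun g => C.x g = 0) with hA
  set O := S.filter (fun g => ¬ C.x g = 0) with hO
  have hcard : A.card + O.card = 33 := by rw [← Multiset.card_add, hAO, hS]
  obtain ⟨v, hv⟩ := zs_pigeon A C.y 8 (by simp; omega)
  have hFW := Multiset.filter_add_not (fun g => C.y g = v) A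
  have hFy : ∀ g ∈ A.filter (fun g => C.y g = v), C.y g = v := fun g hg =>
    (Multiset.mem_filter.1 hg).2
  have hWy : ∀ g ∈ A.filter (fun g => ¬ C.y g = v), C.y g ≠ v := fun g hg =>
    (Multiset.mem_filter.1 hg).2
  set F := A.filter (fun g => C.y g = v) with hF
  set W := A.filter (fun g => ¬ C.y g = v) with hW
  have hcardA : F.card + W.card = A.card := by rw [← Multiset.card_add, hFW]
  by_cases hW2 : 2 ≤ W.card
  · -- two disjoint pairs with different `y`
    obtain ⟨D, hD, hDc⟩ := sub_card W 2 hW2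
    obtain ⟨q1, q2, rfl⟩ := Multiset.card_eq_two.1 hDc
    obtain ⟨D', hD', hDc'⟩ := sub_card F 2 (by omega)
    obtain ⟨p1, p2, rfl⟩ := Multiset.card_eq_two.1 hDc'
    have hq1 := hWy q1 (Multiset.mem_of_le hD (by simp))
    have hq2 := hWy q2 (Multiset.mem_of_le hD (by simp))
    have hp1 := hFy p1 (Multiset.mem_of_le hD' (by simp))
    have hp2 := hFy p2 (Multiset.mem_of_le hD' (by simp))
    have hle4 : {p1, p2} + {q1, q2} ≤ A := by
      rw [← hFW]; exact add_le_add hD' hD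
    obtain ⟨B, hB⟩ := Multiset.le_iff_exists_add.1 hle4
    have hBc : A.card = 4 + B.card := by rw [hB]; simp; omega
    obtain ⟨E, hE, hE0, hEc, hEx⟩ := zs1 O C.x (by omega)
    have hE1 : E.card ≠ 1 := by
      intro h
      obtain ⟨o, rfl⟩ := Multiset.card_eq_one.1 h
      simp at hEx
      exact hOx o (by simpa using hE) hEx
    have hEp := Multiset.card_pos.2 hE0
    obtain ⟨o, ho⟩ := Multiset.card_pos_iff_exists_mem.1 hEp
    obtain ⟨B', hB', hBc'⟩ := sub_card B (25 - E.card) (by omega)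
    have try1 : ∀ r1 r2, {r1, r2} ≤ ({p1, p2} + {q1, q2} : Multiset G) →
        (E.map C.y).sum + (B'.map C.y).sum + C.y r1 + C.y r2 = 0 → R27 S := by
      intro r1 r2 hr hsum
      have hle : {r1, r2} + B' ≤ A := by rw [hB]; exact add_le_add hr hB'
      refine fin (({r1, r2} + B') + E) ?_ ?_ ?_ ?_ o (by simp [ho])
        (hOx o (Multiset.mem_of_le hE ho))
      · rw [← hAO]; exact add_le_add hle hE
      · simp; omega
      · rw [Multiset.map_add, Multiset.sum_add, hEx, add_zero]
        exact sum_zero_of fun t ht => hAx t (Multiset.mem_of_le hle ht)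
      · simp only [Multiset.map_add, Multiset.sum_add, Multiset.insert_eq_cons, Multiset.map_cons,
          Multiset.map_singleton, Multiset.sum_cons, Multiset.sum_singleton]
        linear_combination hsum
    have key : ∀ s v a b : ZMod 3, a ≠ v → b ≠ v →
        s + v + v = 0 ∨ s + v + b = 0 ∨ s + v + a = 0 ∨ s + a + b = 0 := by decide
    rcases key ((E.map C.y).sum + (B'.map C.y).sum) v (C.y q1) (C.y q2) hq1 hq2 with h | h | h | h
    · exact try1 p1 p2 (Multiset.le_add_right _ _) (by rw [hp1, hp2, h])
    · refine try1 p1 q2 ?_ (by rw [hp1, h])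
      exact Multiset.le_iff_exists_add.2 ⟨{p2, q1}, by
        simp only [Multiset.insert_eq_cons, ← Multiset.singleton_add]; abel⟩
    · refine try1 p1 q1 ?_ (by rw [hp1, h])
      exact Multiset.le_iff_exists_add.2 ⟨{p2, q2}, by
        simp only [Multiset.insert_eq_cons, ← Multiset.singleton_add]; abel⟩
    · exact try1 q1 q2 (Multiset.le_add_left _ _) h
  · have hFA : F ≤ A := Multiset.filter_le _ _
    have hAS : A ≤ S := Multiset.filter_le _ _
    by_cases hF29 : 29 ≤ F.card
    · obtain ⟨T, hT, hTc, hTz⟩ := zs_29 F C.z 9 (by omega)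
      have h0 : ∀ t ∈ T, C.x t = 0 := fun t ht => hAx t (Multiset.mem_of_le (hT.trans hFA) ht)
      have h27 : ∀ c : ZMod 3, (27:ℕ) • c = 0 := by decide
      refine ⟨T, hT.trans (hFA.trans hAS), hTc, C.P1_comm T (sum_zero_of h0) ?_ hTz
        (fun a ha b hb => C.om_x0 (h0 a ha) (h0 b hb))⟩
      rw [sum_const T C.y v (fun t ht => hFy t (Multiset.mem_of_le hT ht)), hTc]
      exact h27 v
    · obtain ⟨Q, hQ, hQ0, hQc, hQx, hQy⟩ := zs2 (W + O) C.x (fun g => C.y g - v) (by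
        rw [Multiset.card_add]; omega)
      have hQp := Multiset.card_pos.2 hQ0
      have : ∃ o ∈ Q, C.x o ≠ 0 := by
        by_contra! hcon
        have hQW : Q ≤ W := by
          have h1 : Q ≤ (W + O).filter (fun g => C.x g = 0) := Multiset.le_filter.2 ⟨hQ, hcon⟩
          rw [Multiset.filter_add, Multiset.filter_eq_nil.2 hOx, add_zero] at h1
          exact h1.trans (Multiset.filter_le _ _)
        have := Multiset.card_le_card hQW
        obtain ⟨b, rfl⟩ := Multiset.card_eq_one.1 (show Q.card = 1 by omega)
        simp only [Multiset.map_singleton, Multiset.sum_singleton] at hQy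
        exact hWy b (by simpa using hQW) (sub_eq_zero.1 hQy)
      obtain ⟨o, hoQ, hox⟩ := this
      obtain ⟨F', hF', hFc'⟩ := sub_card F (27 - Q.card) (by omega)
      refine fin (F' + Q) ?_ ?_ ?_ ?_ o (by simp [hoQ]) hox
      · rw [← hAO, ← hFW, add_assoc]; exact add_le_add hF' hQ
      · rw [Multiset.card_add]; omega
      · rw [Multiset.map_add, Multiset.sum_add, hQx, add_zero]
        exact sum_zero_of fun t ht => hAx t (Multiset.mem_of_le (hF'.trans hFA) ht)
      · rw [Multiset.sum_map_sub, sum_const Q (fun _ => v) v (fun _ _ => rfl), sub_eq_zero] at hQy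
        rw [Multiset.map_add, Multiset.sum_add, hQy,
          sum_const F' C.y v (fun t ht => hFy t (Multiset.mem_of_le hF' ht)), ← add_smul, hFc',
          Nat.sub_add_cancel (by omega)]
        have h27 : ∀ c : ZMod 3, (27:ℕ) • c = 0 := by decide
        exact h27 v

/-- unimodular change of coordinates -/
def tr (C : Coords G) (p q r s : ZMod 3) (h : p * s - q * r = 1) : Coords G where
  x g := p * C.x g + q * C.y g
  y g := r * C.x g + s * C.y g
  z := C.z
  x_mul g h := by rw [C.x_mul, C.y_mul]; ring
  y_mul g h := by rw [C.x_mul, C.y_mul]; ring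
  z_mul g k := by
    rw [C.z_mul]
    linear_combination (C.x g * C.y k - C.x k * C.y g) * h
  inj g hx hy hz := by
    apply C.inj g _ _ hz
    · linear_combination s * hx - q * hy - C.x g * h
    · linear_combination p * hy - r * hx - C.y g * h

open Classical in
theorem main33 (C : Coords G) (S : Multiset G) (hS : S.card = 33) : R27 S := by
  rcases C.key15 S hS with h | h15
  · exact h
  obtain ⟨T, hT, hTc, hx, hy⟩ := zs_31 S C.x C.y (by omega)
  have h12 := C.nc12 hT hTc h15
  by_cases hcomm : ∀ a ∈ T, ∀ b ∈ T, C.om a b = 0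
  · obtain ⟨c, hc⟩ := Multiset.card_pos_iff_exists_mem.1
      (lt_of_lt_of_le (by norm_num) h12)
    rw [Multiset.mem_filter] at hc
    have key : ∀ a b : ZMod 3, ¬ (a = 0 ∧ b = 0) → ∃ r s, (-b) * s - a * r = 1 := by decide
    obtain ⟨r, s, hrs⟩ := key _ _ hc.2
    apply (C.tr _ _ r s hrs).caseB S hS
    rw [← hTc]
    apply Multiset.card_le_card
    rw [Multiset.le_filter]
    refine ⟨hT, fun g hg => ?_⟩
    have := hcomm c hc.1 g hg
    simp only [om] at this
    simp only [tr]
    linear_combination this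
  · push Not at hcomm
    obtain ⟨a, ha, b, hb, hab⟩ := hcomm
    exact ⟨T, hT, hTc, C.good T hx hy ha hb hab (by omega)⟩

end Coords

lemma comm_central {G : Type*} [Group G] [Fintype G] (hcard : Fintype.card G = 27)
    (hna : ∃ a b : G, a * b ≠ b * a) (a b : G) :
    a * b * a⁻¹ * b⁻¹ ∈ Subgroup.center G := by
  have hG : Nat.card G = 3 ^ 3 := by rw [Nat.card_eq_fintype_card, hcard]; rfl
  obtain ⟨k, hk0, hk⟩ := IsPGroup.card_center_eq_prime_pow hG (by norm_num)
  have hmul := Subgroup.card_mul_index (Subgroup.center G)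
  rw [hG, hk] at hmul
  have hk3 : k ≤ 3 := by
    by_contra h
    have : 3 ^ 4 ≤ 3 ^ k := Nat.pow_le_pow_right (by norm_num) (by omega)
    have : 3 ^ k ∣ 3 ^ 3 := ⟨_, hmul.symm⟩
    have := Nat.le_of_dvd (by norm_num) this
    omega
  have hnocyc : ¬ IsCyclic (G ⧸ Subgroup.center G) := by
    intro h
    obtain ⟨u, v, huv⟩ := hna
    apply huv
    exact commutative_of_cyclic_center_quotient (QuotientGroup.mk' (Subgroup.center G))
      (by simp) u v
  have hindex : Nat.card (G ⧸ Subgroup.center G) = (Subgroup.center G).index := rfl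
  have hk1 : k = 1 := by
    interval_cases k
    · rfl
    · exfalso
      apply hnocyc
      apply isCyclic_of_prime_card (p := 3)
      omega
    · exfalso
      apply hnocyc
      have : Nat.card (G ⧸ Subgroup.center G) = 1 := by omega
      have := (Nat.card_eq_one_iff_unique.1 this).1
      infer_instance
  subst hk1
  have h9 : Nat.card (G ⧸ Subgroup.center G) = 3 ^ 2 := by omega
  have hc := (IsPGroup.isMulCommutative_of_card_eq_prime_sq h9).is_comm.comm
  rw [← QuotientGroup.eq_one_iff]
  have := hc (a : G ⧸ Subgroup.center G) (b : G ⧸ Subgroup.center G)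
  change (a : G ⧸ Subgroup.center G) * b * (a : G ⧸ Subgroup.center G)⁻¹ * (b : G ⧸ Subgroup.center G)⁻¹ = 1
  rw [this]
  group

lemma pow3_congr {G : Type*} [Group G] {g : G} (hg : g ^ 3 = 1) {m n : ℕ}
    (h : (m : ZMod 3) = n) : g ^ m = g ^ n := by
  have h' : m % 3 = n % 3 := (ZMod.natCast_eq_natCast_iff m n 3).1 h
  rw [← Nat.div_add_mod m 3, ← Nat.div_add_mod n 3, pow_add, pow_add, pow_mul, pow_mul, hg, h']
  simp

lemma swap_pow {G : Type*} [Group G] {a b z : G} (hz : ∀ g, z * g = g * z)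
    (hba : b * a = z ^ 2 * (a * b)) (m n : ℕ) :
    b ^ m * a ^ n = z ^ (2 * n * m) * (a ^ n * b ^ m) := by
  have hzc : ∀ k g, g * z ^ k = z ^ k * g := fun k g =>
    ((show Commute z g from hz g).pow_left k).eq.symm
  have h1 : ∀ n : ℕ, b * a ^ n = z ^ (2 * n) * (a ^ n * b) := by
    intro n
    induction n with
    | zero => simp
    | succ n ih =>
      calc b * a ^ (n + 1) = b * a ^ n * a := by rw [pow_succ, mul_assoc]
        _ = z ^ (2 * n) * (a ^ n * (b * a)) := by rw [ih]; simp only [mul_assoc]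
        _ = z ^ (2 * n) * ((a ^ n * z ^ 2) * (a * b)) := by rw [hba]; simp only [mul_assoc]
        _ = (z ^ (2 * n) * z ^ 2) * ((a ^ n * a) * b) := by rw [hzc]; simp only [mul_assoc]
        _ = _ := by rw [← pow_add, ← pow_succ]; rfl
  induction m with
  | zero => simp
  | succ m ih =>
    calc b ^ (m + 1) * a ^ n = b ^ m * (b * a ^ n) := by rw [pow_succ, mul_assoc]
      _ = (b ^ m * z ^ (2 * n)) * (a ^ n * b) := by rw [h1]; simp only [mul_assoc]
      _ = z ^ (2 * n) * (b ^ m * a ^ n) * b := by rw [hzc]; simp only [mul_assoc]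
      _ = (z ^ (2 * n) * z ^ (2 * n * m)) * (a ^ n * (b ^ m * b)) := by
        rw [ih]; simp only [mul_assoc]
      _ = _ := by rw [← pow_add, ← pow_succ]; congr 2; ring

lemma exists_coords {G : Type*} [Group G] [Fintype G] (hcard : Fintype.card G = 27)
    (hexp : Monoid.exponent G = 3) (hna : ∃ a b : G, a * b ≠ b * a) :
    ∃ (C : Coords G) (a b w : G), C.x a = 1 ∧ C.y a = 0 ∧ C.x b = 0 ∧ C.y b = 1 ∧
      C.x w = 0 ∧ C.y w = 0 ∧ C.z w = 1 := by
  have h3 : ∀ g : G, g ^ 3 = 1 := fun g => by rw [← hexp]; exact Monoid.pow_exponent_eq_one g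
  obtain ⟨a, b, hab⟩ := hna
  have hzc := comm_central hcard ⟨a, b, hab⟩ a b
  obtain ⟨z, hzdef⟩ : ∃ z, z = a * b * a⁻¹ * b⁻¹ := ⟨_, rfl⟩
  rw [← hzdef] at hzc
  have hz : ∀ g, z * g = g * z := fun g => (Subgroup.mem_center_iff.1 hzc g).symm
  have hz1 : z ≠ 1 := by
    intro h
    rw [h] at hzdef
    apply hab
    have := hzdef.symm
    rw [mul_inv_eq_one, mul_inv_eq_iff_eq_mul] at this
    exact this
  have hord : orderOf z = 3 := orderOf_eq_prime (h3 z) hz1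
  have hba : b * a = z ^ 2 * (a * b) := by
    have h1 : a * b = z * (b * a) := by rw [hzdef]; group
    rw [h1, ← mul_assoc, ← pow_succ, h3, one_mul]
  have hsw := swap_pow hz hba
  have hzp : ∀ k g, g * z ^ k = z ^ k * g := fun k g =>
    ((show Commute z g from hz g).pow_left k).eq.symm
  have hmul : ∀ m n k m' n' k' : ℕ, (a ^ m * b ^ n * z ^ k) * (a ^ m' * b ^ n' * z ^ k') =
      a ^ (m + m') * b ^ (n + n') * z ^ (k + k' + 2 * m' * n) := by
    intro m n k m' n' k'
    calc (a ^ m * b ^ n * z ^ k) * (a ^ m' * b ^ n' * z ^ k')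
        = a ^ m * b ^ n * (z ^ k * (a ^ m' * b ^ n')) * z ^ k' := by simp only [mul_assoc]
      _ = a ^ m * (b ^ n * a ^ m') * b ^ n' * (z ^ k * z ^ k') := by
        rw [← hzp]; simp only [mul_assoc]
      _ = a ^ m * (z ^ (2 * m' * n) * (a ^ m' * b ^ n * b ^ n')) * z ^ (k + k') := by
        rw [hsw, pow_add z]; simp only [mul_assoc]
      _ = (a ^ m * a ^ m') * (b ^ n * b ^ n') * (z ^ (2 * m' * n) * z ^ (k + k')) := by
        rw [← hzp]; simp only [mul_assoc]
      _ = _ := by rw [← pow_add, ← pow_add, ← pow_add, add_comm (2 * m' * n)]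
  let E : ZMod 3 × ZMod 3 × ZMod 3 → G := fun t => a ^ t.1.val * b ^ t.2.1.val * z ^ t.2.2.val
  have zinj : ∀ m n : ℕ, z ^ m = z ^ n → (m : ZMod 3) = n := by
    intro m n h
    rw [pow_eq_pow_iff_modEq, hord] at h
    exact (ZMod.natCast_eq_natCast_iff m n 3).2 h
  have hb : ∀ m n k : ℕ, b * (a ^ m * b ^ n * z ^ k) = z ^ (2 * m) * (a ^ m * b ^ n * z ^ k) * b := by
    intro m n k
    have h1 := hmul 0 1 0 m n k
    have h2 := hmul m n (2 * m + k) 0 1 0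
    simp only [pow_zero, one_mul, mul_one, pow_one] at h1 h2
    rw [h1, ← hzp, mul_assoc _ (z ^ k), ← pow_add, add_comm k, h2]
    congr 2 <;> ring
  have ha : ∀ m n k : ℕ, (a ^ m * b ^ n * z ^ k) * a = z ^ (2 * n) * (a * (a ^ m * b ^ n * z ^ k)) := by
    intro m n k
    have h1 := hmul m n k 1 0 0
    have h2 := hmul 1 0 0 m n (k + 2 * n)
    simp only [pow_zero, one_mul, mul_one, pow_one] at h1 h2
    rw [h1, ← hzp, mul_assoc a, mul_assoc _ (z ^ k), ← pow_add, h2]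
    congr 2 <;> ring
  have h22 : ∀ u v : ZMod 3, 2 * u = 2 * v → u = v := by decide
  have Einj : Function.Injective E := by
    rintro ⟨i, j, k⟩ ⟨i', j', k'⟩ h
    simp only [E] at h
    have hi : i = i' := by
      have e1 := hb i.val j.val k.val
      have e2 := hb i'.val j'.val k'.val
      rw [← h] at e2
      have e3 := zinj _ _ (mul_right_cancel (mul_right_cancel (e1.symm.trans e2)))
      push_cast at e3
      simp only [ZMod.natCast_val, ZMod.cast_id', id] at e3
      exact h22 _ _ e3
    have hj : j = j' := by
      have e1 := ha i.val j.val k.val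
      have e2 := ha i'.val j'.val k'.val
      rw [← h] at e2
      have e3 := zinj _ _ (mul_right_cancel (e1.symm.trans e2))
      push_cast at e3
      simp only [ZMod.natCast_val, ZMod.cast_id', id] at e3
      exact h22 _ _ e3
    subst hi hj
    have e3 := zinj _ _ (mul_left_cancel h)
    simp only [ZMod.natCast_val, ZMod.cast_id', id] at e3
    rw [e3]
  have Ebij : Function.Bijective E := by
    rw [Fintype.bijective_iff_injective_and_card]
    exact ⟨Einj, by rw [hcard]; simp [ZMod.card]⟩
  let e := Equiv.ofBijective E Ebij
  have he : ∀ t, e t = E t := fun t => rfl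
  have hEmul : ∀ t t', E t * E t' =
      E (t.1 + t'.1, t.2.1 + t'.2.1, t.2.2 + t'.2.2 + 2 * t'.1 * t.2.1) := by
    intro t t'
    simp only [E]
    rw [hmul]
    congr 1
    · congr 1
      · apply pow3_congr (h3 a); push_cast; simp
      · apply pow3_congr (h3 b); push_cast; simp
    · apply pow3_congr (h3 z); push_cast; simp
  have hsymm : ∀ g h, e.symm (g * h) = ((e.symm g).1 + (e.symm h).1,
      (e.symm g).2.1 + (e.symm h).2.1,
      (e.symm g).2.2 + (e.symm h).2.2 + 2 * (e.symm h).1 * (e.symm g).2.1) := by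
    intro g h
    rw [Equiv.symm_apply_eq, he, ← hEmul, ← he, ← he]
    simp
  have t3 : (3 : ZMod 3) = 0 := by decide
  refine ⟨{ x := fun g => (e.symm g).1
            y := fun g => (e.symm g).2.1
            z := fun g => (e.symm g).2.2 - (e.symm g).1 * (e.symm g).2.1
            x_mul := fun g h => by rw [hsymm]
            y_mul := fun g h => by rw [hsymm]
            z_mul := fun g h => by rw [hsymm]; dsimp only; ring
            inj := ?_ }, e (1, 0, 0), e (0, 1, 0), e (0, 0, 1), ?_⟩
  · intro g hx hy hz
    have : e.symm g = (0, 0, 0) := by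
      have hx' : (e.symm g).1 = 0 := hx
      have hy' : (e.symm g).2.1 = 0 := hy
      have hz' : (e.symm g).2.2 = 0 := by simpa [hx', hy'] using hz
      exact Prod.ext hx' (Prod.ext hy' hz')
    rw [Equiv.symm_apply_eq] at this
    rw [this, he]
    simp [E]
  · simp

lemma P1_list {G : Type*} [Group G] {T S : Multiset G} (h : P1 T) (hT : T ≤ S) :
    ∃ l : List G, (l : Multiset G) ≤ S ∧ l.length = T.card ∧ l.prod = 1 := by
  obtain ⟨l, rfl, hl⟩ := h
  exact ⟨l, hT, by simp, hl⟩

lemma le_add_split {α : Type*} [DecidableEq α] {T U V : Multiset α} (h : T ≤ U + V) :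
    ∃ T1 ≤ U, ∃ T2 ≤ V, T = T1 + T2 :=
  ⟨T ∩ U, Multiset.inter_le_right, T - U, tsub_le_iff_left.2 h, by
    ext a; simp only [Multiset.count_add, Multiset.count_inter, Multiset.count_sub]; omega⟩

open Classical in
lemma free6 {G : Type*} [Group G] (C : Coords G) {a b w : G} (ha : C.x a = 1) (ha' : C.y a = 0)
    (hb : C.x b = 0) (hb' : C.y b = 1) (hw : C.x w = 0) (hw' : C.y w = 0) (hw1 : C.z w = 1) :
    ¬ HasProdOneSubseq (Multiset.replicate 2 a + (Multiset.replicate 2 b +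
      Multiset.replicate 2 w)) := by
  rintro ⟨l, hl0, hl, hp⟩
  obtain ⟨A, hA, R, hR, hT⟩ := le_add_split hl
  obtain ⟨B, hB, W, hW, rfl⟩ := le_add_split hR
  obtain ⟨i, hi, rfl⟩ := Multiset.le_replicate_iff.1 hA
  obtain ⟨j, hj, rfl⟩ := Multiset.le_replicate_iff.1 hB
  obtain ⟨k, hk, rfl⟩ := Multiset.le_replicate_iff.1 hW
  have small : ∀ n : ℕ, n ≤ 2 → (n : ZMod 3) = 0 → n = 0 := by
    intro n hn h
    have := zmod_card_dvd n h
    omega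
  have ex := C.x_of_coe hT
  have ey := C.y_of_coe hT
  rw [hp, C.x_one] at ex
  rw [hp, C.y_one] at ey
  simp [ha, hb, hw] at ex
  simp [ha', hb', hw'] at ey
  have hi0 := small i hi (by simpa using ex.symm)
  have hj0 := small j hj (by simpa using ey.symm)
  subst hi0 hj0
  simp at hT
  have hm : ∀ g ∈ l, g = w := by
    intro g hg
    have : g ∈ (l : Multiset G) := hg
    rw [hT] at this
    exact Multiset.eq_of_mem_replicate this
  have hz := C.z_comm_prod l (by
    intro g hg h hh
    rw [hm g hg, hm h hh, C.om_self])
  have hz2 : (l.map C.z).sum = ((l : Multiset G).map C.z).sum := by simp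
  rw [hp, C.z_one, hz2, hT] at hz
  simp [hw1] at hz
  have hk0 := small k hk (by simpa using hz.symm)
  subst hk0
  simp at hT
  exact hl0 hT

lemma prod_filter_ne_one {G : Type*} [Group G] [DecidableEq G] (l : List G) :
    (l.filter (fun g => ¬ g = 1)).prod = l.prod := by
  induction l with
  | nil => rfl
  | cons a l ih =>
    by_cases h : a = 1
    · subst h; simpa using ih
    · simp [h] at ih ⊢; exact ih

theorem stmt_19 {G : Type*} [Group G] [Fintype G]
    (hcard : Fintype.card G = 27)
    (hexp : Monoid.exponent G = 3)
    (hna : ∃ a b : G, a * b ≠ b * a) :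
    (∀ S : Multiset G, Multiset.card S = 33 →
      ∃ l : List G, (l : Multiset G) ≤ S ∧ l.length = 27 ∧ l.prod = 1) ∧
    gaoConstant G = 33 ∧ gaoConstant G = smallDavenport G + Nat.card G := by
  classical
  obtain ⟨C, a, b, w, ha, ha', hb, hb', hw, hw', hw1⟩ := exists_coords hcard hexp hna
  have hfree := free6 C ha ha' hb hb' hw hw' hw1
  set X := Multiset.replicate 2 a + (Multiset.replicate 2 b + Multiset.replicate 2 w) with hX
  have hXc : X.card = 6 := by simp [hX]
  have hN : Nat.card G = 27 := by rw [Nat.card_eq_fintype_card, hcard]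
  have h33 : ∀ S : Multiset G, Multiset.card S = 33 →
      ∃ l : List G, (l : Multiset G) ≤ S ∧ l.length = 27 ∧ l.prod = 1 := by
    intro S hS
    obtain ⟨T, hT, hTc, hP⟩ := C.main33 S hS
    rw [← hTc]
    exact P1_list hP hT
  have hgao : gaoConstant G = 33 := by
    unfold gaoConstant
    rw [hN]
    apply le_antisymm
    · apply Nat.sInf_le
      intro S hS
      obtain ⟨S', hS', hc⟩ := sub_card S 33 hS
      obtain ⟨l, h1, h2⟩ := h33 S' hc
      exact ⟨l, h1.trans hS', h2⟩
    · refine le_csInf ⟨33, ?_⟩ ?_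
      · intro S hS
        obtain ⟨S', hS', hc⟩ := sub_card S 33 hS
        obtain ⟨l, h1, h2⟩ := h33 S' hc
        exact ⟨l, h1.trans hS', h2⟩
      · intro N hmem
        by_contra hlt
        obtain ⟨l, hl, hlen, hp⟩ := hmem (Multiset.replicate 26 1 + X) (by
          rw [Multiset.card_add, hXc, Multiset.card_replicate]; omega)
        have hX1 : ∀ g ∈ X, ¬ g = 1 := by
          rintro g hg rfl
          exact hfree ⟨[1], by simp, by simpa using hg, by simp⟩
        apply hfree
        refine ⟨l.filter (fun g => ¬ g = 1), ?_, ?_, ?_⟩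
        · intro hnil
          have hall : ∀ g ∈ (l : Multiset G), g = 1 := by
            intro g hg
            by_contra hne
            have : g ∈ l.filter (fun g => ¬ g = 1) := by
              rw [List.mem_filter]; exact ⟨hg, by simpa using hne⟩
            rw [hnil] at this
            simp at this
          have h1 := Multiset.card_le_card
            (Multiset.le_filter.2 ⟨hl, hall⟩)
          rw [Multiset.filter_add, Multiset.filter_eq_nil.2 hX1, add_zero] at h1
          have h2 := Multiset.card_le_card
            (Multiset.filter_le (fun g : G => g = 1) (Multiset.replicate 26 1))
          rw [Multiset.card_replicate] at h2
          rw [Multiset.coe_card] at h1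
          omega
        · have h1 := Multiset.filter_le_filter (fun g => ¬ g = 1) hl
          have h0 : (Multiset.replicate 26 (1 : G)).filter (fun g => ¬ g = 1) = 0 :=
            Multiset.filter_eq_nil.2 (by
              intro g hg; simp [Multiset.eq_of_mem_replicate hg])
          rw [Multiset.filter_add, Multiset.filter_eq_self.2 hX1, h0, zero_add] at h1
          simpa using h1
        · rw [prod_filter_ne_one, hp]
  have hdav : smallDavenport G = 6 := by
    unfold smallDavenport
    have hub : ∀ n ∈ {n | ∃ S : Multiset G, Multiset.card S = n ∧ ¬ HasProdOneSubseq S},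
        n ≤ 6 := by
      rintro n ⟨S, rfl, hS⟩
      by_contra hlt
      apply hS
      obtain ⟨T, hT, hT0, l, rfl, hl⟩ := C.dav S (by omega)
      exact ⟨l, by simpa using hT0, hT, hl⟩
    exact le_antisymm (csSup_le ⟨6, X, hXc, hfree⟩ hub) (le_csSup ⟨6, hub⟩ ⟨X, hXc, hfree⟩)
  refine ⟨h33, hgao, ?_⟩
  rw [hgao, hdav, hN]
end
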